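/- arXiv:1905.05978 — 2 statements merged into one kernel-verified Lean document; each statement's English description precedes it below -/
import Mathlib

section
/- Let f : {0,1}^n → {0,1} be an increasing boolean function and p ≤ 1/2. Then for any ε, δ ∈ (0,1), setting k = exp(10^{12} ⌈I_f(p)⌉² (δε)^{-2}), one has μ_p({x : f(x) = 1} \ B_{δ,k}) ≤ ε. -/
open scoped Classical

noncomputable section

/-- Bernoulli(p) product weight of a point `x ∈ {0,1}^n`. -/
def wt {n : ℕ} (p : ℝ) (x : Fin n → Bool) : ℝ :=
  p ^ (Finset.univ.filter fun i => x i = true).card *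
    (1 - p) ^ (Finset.univ.filter fun i => x i = false).card

/-- The product measure `μ_p` of an event `E ⊆ {0,1}^n`. -/
def mup {n : ℕ} (p : ℝ) (E : Set (Fin n → Bool)) : ℝ :=
  ∑ x : Fin n → Bool, if x ∈ E then wt p x else 0

/-- The total influence `I_f(p) = ∑_i ℙ(f(X) ≠ f(X_{{i}}))`, where `X ∼ μ_p`
and `X_{{i}}` has its `i`-th coordinate resampled independently. -/
def totalInfluence {n : ℕ} (p : ℝ) (f : (Fin n → Bool) → Bool) : ℝ :=
  ∑ i : Fin n, ∑ x : Fin n → Bool, ∑ b : Bool,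
    wt p x * (if b then p else 1 - p) *
      (if f x = f (Function.update x i b) then 0 else 1)

/-- `f` is an increasing boolean function. -/
def IncreasingBool {n : ℕ} (f : (Fin n → Bool) → Bool) : Prop :=
  ∀ x y : Fin n → Bool, (∀ i, x i ≤ y i) → f x ≤ f y

/-- `S` is a `(1-δ)`-boosting set for `f` at parameter `p`:
`E_{μ_p}[f | x_S = (1,…,1)] ≥ 1 - δ`. -/
def BoostingSet {n : ℕ} (p δ : ℝ) (f : (Fin n → Bool) → Bool) (S : Finset (Fin n)) : Prop :=
  mup p {x | f x = true ∧ ∀ i ∈ S, x i = true} ≥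
    (1 - δ) * mup p {x | ∀ i ∈ S, x i = true}

/-- `B_{δ,k}`: the event that `{i : x_i = 1}` contains a `(1-δ)`-boosting set
of cardinality at most `k`. -/
def Bev {n : ℕ} (p δ : ℝ) (k : ℝ) (f : (Fin n → Bool) → Bool) : Set (Fin n → Bool) :=
  {x | ∃ S : Finset (Fin n), (S.card : ℝ) ≤ k ∧ (∀ i ∈ S, x i = true) ∧
        BoostingSet p δ f S}


/-- Expectation under `μ_p`. -/
def Ex {n : ℕ} (p : ℝ) (φ : (Fin n → Bool) → ℝ) : ℝ := ∑ x, wt p x * φ x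

/-- Biased Rademacher variable. -/
def rr (s : ℝ) (b : Bool) : ℝ := if b then s else -s⁻¹

/-- Walsh character. -/
def chi {n : ℕ} (s : ℝ) (S : Finset (Fin n)) (x : Fin n → Bool) : ℝ := ∏ i ∈ S, rr s (x i)

/-- Fourier-Walsh coefficient. -/
def hat {n : ℕ} (p s : ℝ) (φ : (Fin n → Bool) → ℝ) (S : Finset (Fin n)) : ℝ :=
  Ex p (fun x => φ x * chi s S x)

lemma wt_eq_prod {n : ℕ} (p : ℝ) (x : Fin n → Bool) :
    wt p x = ∏ i, (if x i = true then p else 1 - p) := by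
  unfold wt
  rw [Finset.prod_ite]
  simp [Finset.prod_const]

lemma wt_pos {n : ℕ} {p : ℝ} (hp : 0 < p) (hp1 : p < 1) (x : Fin n → Bool) : 0 < wt p x := by
  unfold wt
  have : 0 < 1 - p := by linarith
  positivity

lemma Ex_add {n : ℕ} (p : ℝ) (φ ψ : (Fin n → Bool) → ℝ) :
    Ex p (fun x => φ x + ψ x) = Ex p φ + Ex p ψ := by
  simp [Ex, mul_add, Finset.sum_add_distrib]

lemma Ex_sub {n : ℕ} (p : ℝ) (φ ψ : (Fin n → Bool) → ℝ) :
    Ex p (fun x => φ x - ψ x) = Ex p φ - Ex p ψ := by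
  simp [Ex, mul_sub, Finset.sum_sub_distrib]

lemma Ex_mul {n : ℕ} (p c : ℝ) (φ : (Fin n → Bool) → ℝ) :
    Ex p (fun x => c * φ x) = c * Ex p φ := by
  simp only [Ex, Finset.mul_sum]
  exact Finset.sum_congr rfl fun x _ => by ring

lemma Ex_sum {n : ℕ} {ι : Type*} (p : ℝ) (t : Finset ι) (φ : ι → (Fin n → Bool) → ℝ) :
    Ex p (fun x => ∑ j ∈ t, φ j x) = ∑ j ∈ t, Ex p (φ j) := by
  simp only [Ex, Finset.mul_sum]
  exact Finset.sum_comm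

lemma Ex_mono {n : ℕ} {p : ℝ} (hp : 0 < p) (hp1 : p < 1) {φ ψ : (Fin n → Bool) → ℝ}
    (h : ∀ x, φ x ≤ ψ x) : Ex p φ ≤ Ex p ψ :=
  Finset.sum_le_sum fun x _ => mul_le_mul_of_nonneg_left (h x) (wt_pos hp hp1 x).le

lemma Ex_one {n : ℕ} (p : ℝ) : Ex (n := n) p (fun _ => 1) = 1 := by
  simp only [Ex, mul_one, wt_eq_prod]
  have := Finset.prod_univ_sum (fun _ : Fin n => (Finset.univ : Finset Bool))
    (fun _ b => if b = true then p else 1 - p)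
  simp at this
  exact this.symm

/-- averaging over coordinate `i` -/
lemma Ex_avg {n : ℕ} (p : ℝ) (i : Fin n) (φ : (Fin n → Bool) → ℝ) :
    Ex p φ = Ex p (fun x => p * φ (Function.update x i true)
      + (1 - p) * φ (Function.update x i false)) := by
  have key : ∀ F : (Fin n → Bool) → ℝ, ∑ x, F x = ∑ x, F (Function.update x i (!(x i))) := by
    intro F
    refine (Fintype.sum_equiv (Function.Involutive.toPerm
      (fun x : Fin n → Bool => Function.update x i (!(x i))) ?_) _ _ ?_).symm
    · intro x; simp
    · intro x; rfl
  have hw : ∀ (x : Fin n → Bool) b, wt p (Function.update x i b) =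
      (if b = true then p else 1 - p) * ∏ j ∈ Finset.univ.erase i,
        (if x j = true then p else 1 - p) := by
    intro x b
    rw [wt_eq_prod, ← Finset.mul_prod_erase _ _ (Finset.mem_univ i)]
    congr 1
    · simp
    · refine Finset.prod_congr rfl fun j hj => ?_
      rw [Function.update_of_ne (Finset.ne_of_mem_erase hj)]
  have h2 : ∀ F : (Fin n → Bool) → ℝ, 2 * ∑ x, F x
      = ∑ x, (F (Function.update x i true) + F (Function.update x i false)) := by
    intro F
    rw [two_mul]
    nth_rewrite 2 [key F]
    rw [← Finset.sum_add_distrib]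
    refine Finset.sum_congr rfl fun x _ => ?_
    have hx : F x = F (Function.update x i (x i)) := by simp
    rw [hx]
    cases h : x i <;> simp [add_comm]
  have : 2 * Ex p φ = 2 * Ex p (fun x => p * φ (Function.update x i true)
      + (1 - p) * φ (Function.update x i false)) := by
    unfold Ex
    rw [h2, h2]
    refine Finset.sum_congr rfl fun x _ => ?_
    simp only [Function.update_idem, hw]
    simp
    ring
  linarith

lemma Ex_indep {n : ℕ} (p : ℝ) (i : Fin n) (ψ : Bool → ℝ) (φ : (Fin n → Bool) → ℝ)
    (h : ∀ x b, φ (Function.update x i b) = φ x) :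
    Ex p (fun x => ψ (x i) * φ x) = (p * ψ true + (1 - p) * ψ false) * Ex p φ := by
  rw [Ex_avg p i, ← Ex_mul]
  congr 1
  funext x
  simp [h]
  ring

lemma chi_update {n : ℕ} (s : ℝ) {S : Finset (Fin n)} {i : Fin n} (hi : i ∉ S)
    (x : Fin n → Bool) (b : Bool) : chi s S (Function.update x i b) = chi s S x := by
  unfold chi
  refine Finset.prod_congr rfl fun j hj => ?_
  rw [Function.update_of_ne]
  rintro rfl
  exact hi hj

lemma chi_insert {n : ℕ} (s : ℝ) {S : Finset (Fin n)} {i : Fin n} (hi : i ∉ S)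
    (x : Fin n → Bool) : chi s (insert i S) x = rr s (x i) * chi s S x := by
  unfold chi
  rw [Finset.prod_insert hi]

lemma rr_mean {p s : ℝ} (hs : 1 ≤ s) (hps : p * (1 + s ^ 2) = 1) :
    p * rr s true + (1 - p) * rr s false = 0 := by
  have hs0 : s ≠ 0 := by positivity
  have : 1 - p = p * s ^ 2 := by linarith
  simp [rr, this]
  field_simp
  ring

lemma kernel_sum {n : ℕ} {p s : ℝ} (hs : 1 ≤ s) (hps : p * (1 + s ^ 2) = 1)
    (x y : Fin n → Bool) :
    wt p x * ∑ S : Finset (Fin n), chi s S x * chi s S y = if x = y then 1 else 0 := by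
  have hs0 : s ≠ 0 := by positivity
  have hq : 1 - p = p * s ^ 2 := by linarith
  have h1 : ∑ S : Finset (Fin n), chi s S x * chi s S y
      = ∏ i : Fin n, (1 + rr s (x i) * rr s (y i)) := by
    rw [Finset.prod_one_add]
    simp [chi, Finset.prod_mul_distrib]
  rw [h1, wt_eq_prod, ← Finset.prod_mul_distrib]
  have h2 : ∀ i, ((if x i = true then p else 1 - p) * (1 + rr s (x i) * rr s (y i)))
      = if x i = y i then 1 else 0 := by
    intro i
    cases x i <;> cases y i <;> simp [rr, hq, hs0] <;> field_simp <;> linarith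
  simp only [h2]
  split_ifs with hxy
  · subst hxy; simp
  · obtain ⟨i, hi⟩ := Function.ne_iff.mp hxy
    exact Finset.prod_eq_zero (Finset.mem_univ i) (by simp [hi])

lemma plancherel {n : ℕ} {p s : ℝ} (hs : 1 ≤ s) (hps : p * (1 + s ^ 2) = 1)
    (φ ψ : (Fin n → Bool) → ℝ) :
    ∑ S, hat p s φ S * hat p s ψ S = Ex p (fun x => φ x * ψ x) := by
  have : ∀ S, hat p s φ S * hat p s ψ S = ∑ x, ∑ y, (wt p y * φ x * ψ y) *
      (wt p x * (chi s S x * chi s S y)) := by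
    intro S
    unfold hat Ex
    rw [Finset.sum_mul_sum]
    refine Finset.sum_congr rfl fun x _ => Finset.sum_congr rfl fun y _ => by ring
  simp only [this]
  rw [Finset.sum_comm]
  unfold Ex
  refine Finset.sum_congr rfl fun x _ => ?_
  rw [Finset.sum_comm]
  simp only [← Finset.mul_sum, kernel_sum hs hps]
  simp
  ring

lemma hat_sub {n : ℕ} (p s : ℝ) (φ ψ : (Fin n → Bool) → ℝ) (S : Finset (Fin n)) :
    hat p s (fun x => φ x - ψ x) S = hat p s φ S - hat p s ψ S := by
  unfold hat
  rw [← Ex_sub]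
  congr 1; funext x; ring

lemma hat_indep {n : ℕ} {p s : ℝ} (hs : 1 ≤ s) (hps : p * (1 + s ^ 2) = 1)
    (φ : (Fin n → Bool) → ℝ) (i : Fin n) (S : Finset (Fin n)) (hi : i ∈ S)
    (h : ∀ x b, φ (Function.update x i b) = φ x) : hat p s φ S = 0 := by
  unfold hat
  have h1 : ∀ x, φ x * chi s S x = rr s (x i) * (φ x * chi s (S.erase i) x) := by
    intro x
    have := chi_insert s (Finset.notMem_erase i S) x
    rw [Finset.insert_erase hi] at this
    rw [this]; ring
  simp only [h1]
  rw [Ex_indep p i (rr s) (fun x => φ x * chi s (S.erase i) x), rr_mean hs hps, zero_mul]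
  intro x b
  simp only [h, chi_update s (Finset.notMem_erase i S)]

lemma pointwise4 {p s : ℝ} (hs : 1 ≤ s) (hps : p * (1 + s ^ 2) = 1) (a a' b b' : ℝ) :
    p * ((a + s * a') ^ 2 * (b + s * b') ^ 2)
      + (1 - p) * ((a + -s⁻¹ * a') ^ 2 * (b + -s⁻¹ * b') ^ 2)
    ≤ a ^ 2 * b ^ 2 + 4 * (a ^ 2 * b' ^ 2) + 4 * (a' ^ 2 * b ^ 2)
      + 3 * s ^ 2 * (a' ^ 2 * b' ^ 2) := by
  have hs0 : s ≠ 0 := by positivity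
  obtain ⟨w, hw⟩ : ∃ w, w = s⁻¹ := ⟨_, rfl⟩
  have hsw : s * w = 1 := by rw [hw]; field_simp
  have hw0 : 0 < w := by rw [hw]; positivity
  have hw1 : w ≤ 1 := by rw [hw]; exact inv_le_one_of_one_le₀ hs
  have hpp : p = w ^ 2 / (1 + w ^ 2) := by
    rw [hw]; field_simp; linarith
  have hE : p * ((a + s * a') ^ 2 * (b + s * b') ^ 2)
      + (1 - p) * ((a + -s⁻¹ * a') ^ 2 * (b + -s⁻¹ * b') ^ 2)
      = a ^ 2 * b ^ 2 + a ^ 2 * b' ^ 2 + a' ^ 2 * b ^ 2 + 4 * (a * a' * b * b')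
        + (s - w) * (2 * a * a' * b' ^ 2 + 2 * a' ^ 2 * b * b')
        + (s ^ 2 - 1 + w ^ 2) * (a' ^ 2 * b' ^ 2) := by
    have hs' : s = w⁻¹ := by rw [hw]; simp
    rw [← hw, hpp, hs']
    have : (1 + w ^ 2) ≠ 0 := by positivity
    field_simp
    ring
  rw [hE]
  have e1 : 0 ≤ (a * b' - a' * b) ^ 2 := sq_nonneg _
  have hm : 0 ≤ s - w := by linarith
  have hms : (s - w) ^ 2 ≤ s ^ 2 := by
    apply pow_le_pow_left₀ hm; linarith
  have e2 : 0 ≤ (a * b' - (s - w) * (a' * b')) ^ 2 := sq_nonneg _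
  have e3 : 0 ≤ (a' * b - (s - w) * (a' * b')) ^ 2 := sq_nonneg _
  have e4 : (s - w) ^ 2 * (a' * b') ^ 2 ≤ s ^ 2 * (a' * b') ^ 2 :=
    mul_le_mul_of_nonneg_right hms (sq_nonneg _)
  have e5 : w ^ 2 * (a' * b') ^ 2 ≤ 1 * (a' * b') ^ 2 :=
    mul_le_mul_of_nonneg_right (by nlinarith) (sq_nonneg _)
  nlinarith

/-- polynomial with coefficients `c` supported in `V` -/
def poly {n : ℕ} (s : ℝ) (c : Finset (Fin n) → ℝ) (V : Finset (Fin n)) (x : Fin n → Bool) : ℝ :=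
  ∑ S ∈ V.powerset, c S * chi s S x

/-- weighted mass above `U` -/
def alph {n : ℕ} (c : Finset (Fin n) → ℝ) (V U : Finset (Fin n)) : ℝ :=
  ∑ S ∈ V.powerset, if U ⊆ S then 4 ^ S.card * c S ^ 2 else 0

lemma poly_insert {n : ℕ} (s : ℝ) (c : Finset (Fin n) → ℝ) {V : Finset (Fin n)} {i : Fin n}
    (hi : i ∉ V) (x : Fin n → Bool) :
    poly s c (insert i V) x = poly s c V x
      + rr s (x i) * poly s (fun S => c (insert i S)) V x := by
  unfold poly
  rw [Finset.sum_powerset_insert hi, Finset.mul_sum]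
  congr 1
  refine Finset.sum_congr rfl fun S hS => ?_
  rw [chi_insert s (fun h => hi (Finset.mem_powerset.mp hS h))]
  ring

lemma poly_update {n : ℕ} (s : ℝ) (c : Finset (Fin n) → ℝ) {V : Finset (Fin n)} {i : Fin n}
    (hi : i ∉ V) (x : Fin n → Bool) (b : Bool) :
    poly s c V (Function.update x i b) = poly s c V x := by
  unfold poly
  refine Finset.sum_congr rfl fun S hS => ?_
  rw [chi_update s (fun h => hi (Finset.mem_powerset.mp hS h))]

lemma alph_insert {n : ℕ} (c : Finset (Fin n) → ℝ) {V U : Finset (Fin n)} {i : Fin n}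
    (hi : i ∉ V) (hU : U ⊆ V) :
    alph c (insert i V) U = alph c V U + 4 * alph (fun S => c (insert i S)) V U := by
  unfold alph
  rw [Finset.sum_powerset_insert hi, Finset.mul_sum]
  congr 1
  refine Finset.sum_congr rfl fun S hS => ?_
  have hiS : i ∉ S := fun h => hi (Finset.mem_powerset.mp hS h)
  have hiU : i ∉ U := fun h => hi (hU h)
  simp only [Finset.card_insert_of_notMem hiS, Finset.subset_insert_iff_of_notMem hiU]
  split_ifs
  · ring
  · ring

lemma alph_insert' {n : ℕ} (c : Finset (Fin n) → ℝ) {V U : Finset (Fin n)} {i : Fin n}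
    (hi : i ∉ V) (hU : U ⊆ V) :
    alph c (insert i V) (insert i U) = 4 * alph (fun S => c (insert i S)) V U := by
  unfold alph
  rw [Finset.sum_powerset_insert hi, Finset.mul_sum]
  have h0 : (∑ S ∈ V.powerset, if insert i U ⊆ S then 4 ^ S.card * c S ^ 2 else 0) = 0 := by
    refine Finset.sum_eq_zero fun S hS => ?_
    have hiS : i ∉ S := fun h => hi (Finset.mem_powerset.mp hS h)
    rw [if_neg]
    intro h
    exact hiS (h (Finset.mem_insert_self _ _))
  rw [h0, zero_add]
  refine Finset.sum_congr rfl fun S hS => ?_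
  have hiS : i ∉ S := fun h => hi (Finset.mem_powerset.mp hS h)
  have hiU : i ∉ U := fun h => hi (hU h)
  simp only [Finset.card_insert_of_notMem hiS, Finset.insert_subset_insert_iff hiU]
  split_ifs
  · ring
  · ring

lemma alph_nonneg {n : ℕ} (c : Finset (Fin n) → ℝ) (V U : Finset (Fin n)) :
    0 ≤ alph c V U :=
  Finset.sum_nonneg fun S _ => by split_ifs <;> positivity

/-- global hypercontractivity (bilinear form) -/
lemma hyper {n : ℕ} {p s : ℝ} (hp : 0 < p) (hp1 : p < 1) (hs : 1 ≤ s)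
    (hps : p * (1 + s ^ 2) = 1) (V : Finset (Fin n)) :
    ∀ c d : Finset (Fin n) → ℝ,
    Ex p (fun x => poly s c V x ^ 2 * poly s d V x ^ 2)
      ≤ ∑ U ∈ V.powerset, (s ^ 2) ^ U.card * (alph c V U * alph d V U) := by
  induction V using Finset.induction_on with
  | empty =>
    intro c d
    simp [poly, alph, chi]
    have : (fun _ : Fin n → Bool => c ∅ ^ 2 * d ∅ ^ 2) = fun _ => (c ∅ ^ 2 * d ∅ ^ 2) * 1 := by
      simp
    rw [this, Ex_mul, Ex_one]
    simp
  | insert i V hi ih =>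
    intro c d
    set c' := fun S => c (insert i S) with hc'
    set d' := fun S => d (insert i S) with hd'
    have h1 : Ex p (fun x => poly s c (insert i V) x ^ 2 * poly s d (insert i V) x ^ 2)
        ≤ Ex p (fun x => poly s c V x ^ 2 * poly s d V x ^ 2)
        + 4 * Ex p (fun x => poly s c V x ^ 2 * poly s d' V x ^ 2)
        + 4 * Ex p (fun x => poly s c' V x ^ 2 * poly s d V x ^ 2)
        + 3 * s ^ 2 * Ex p (fun x => poly s c' V x ^ 2 * poly s d' V x ^ 2) := by
      rw [Ex_avg p i, ← Ex_mul, ← Ex_mul, ← Ex_mul, ← Ex_add, ← Ex_add, ← Ex_add]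
      refine Ex_mono hp hp1 fun x => ?_
      simp only [poly_insert s _ hi, poly_update s _ hi, Function.update_self]
      have := pointwise4 hs hps (poly s c V x) (poly s c' V x) (poly s d V x) (poly s d' V x)
      simpa [rr] using this
    refine h1.trans ?_
    have i1 := ih c d
    have i2 := ih c d'
    have i3 := ih c' d
    have i4 := ih c' d'
    rw [Finset.sum_powerset_insert hi]
    have h2 : ∀ U ∈ V.powerset, (s ^ 2) ^ U.card * (alph c (insert i V) U * alph d (insert i V) U)
        = (s ^ 2) ^ U.card * (alph c V U * alph d V U)
        + 4 * ((s ^ 2) ^ U.card * (alph c V U * alph d' V U))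
        + 4 * ((s ^ 2) ^ U.card * (alph c' V U * alph d V U))
        + 16 * ((s ^ 2) ^ U.card * (alph c' V U * alph d' V U)) := by
      intro U hU
      rw [alph_insert c hi (Finset.mem_powerset.mp hU), alph_insert d hi (Finset.mem_powerset.mp hU)]
      ring
    have h3 : ∀ U ∈ V.powerset, (s ^ 2) ^ (insert i U).card *
        (alph c (insert i V) (insert i U) * alph d (insert i V) (insert i U))
        = 16 * s ^ 2 * ((s ^ 2) ^ U.card * (alph c' V U * alph d' V U)) := by
      intro U hU
      have hiU : i ∉ U := fun h => hi (Finset.mem_powerset.mp hU h)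
      rw [alph_insert' c hi (Finset.mem_powerset.mp hU),
        alph_insert' d hi (Finset.mem_powerset.mp hU), Finset.card_insert_of_notMem hiU]
      ring
    rw [Finset.sum_congr rfl h2, Finset.sum_congr rfl h3]
    simp only [Finset.sum_add_distrib, ← Finset.mul_sum]
    have h4 : 0 ≤ ∑ U ∈ V.powerset, (s ^ 2) ^ U.card * (alph c' V U * alph d' V U) :=
      Finset.sum_nonneg fun U _ => mul_nonneg (by positivity)
        (mul_nonneg (alph_nonneg _ _ _) (alph_nonneg _ _ _))
    have h5 : 3 * s ^ 2 * Ex p (fun x => poly s c' V x ^ 2 * poly s d' V x ^ 2) ≤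
        3 * s ^ 2 * ∑ U ∈ V.powerset, (s ^ 2) ^ U.card * (alph c' V U * alph d' V U) :=
      mul_le_mul_of_nonneg_left i4 (by positivity)
    have h6 : 0 ≤ s ^ 2 * ∑ U ∈ V.powerset, (s ^ 2) ^ U.card * (alph c' V U * alph d' V U) :=
      mul_nonneg (by positivity) h4
    nlinarith

/-- normalized mass above `T` -/
def WW {n : ℕ} (a : Finset (Fin n) → ℝ) (z : ℝ) (K : ℕ) (T : Finset (Fin n)) : ℝ :=
  (z⁻¹) ^ T.card * ∑ S, if T ⊆ S ∧ S.card ≤ K then a S else 0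

/-- heavy sets -/
def heavy {n : ℕ} (a : Finset (Fin n) → ℝ) (z : ℝ) (K : ℕ) (τ : ℝ) (T : Finset (Fin n)) : Prop :=
  T.card ≤ K ∧ τ ≤ WW a z K T

/-- union of the subsets of `S` satisfying `H` -/
def MM {n : ℕ} (H : Finset (Fin n) → Prop) (S : Finset (Fin n)) : Finset (Fin n) :=
  (S.powerset.filter H).biUnion id

lemma mem_MM {n : ℕ} {H : Finset (Fin n) → Prop} {S : Finset (Fin n)} {i : Fin n} :
    i ∈ MM H S ↔ ∃ T, T ⊆ S ∧ H T ∧ i ∈ T := by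
  simp [MM, and_assoc]

lemma MM_subset {n : ℕ} (H : Finset (Fin n) → Prop) (S : Finset (Fin n)) : MM H S ⊆ S := by
  intro i hi
  obtain ⟨T, hT, -, hiT⟩ := mem_MM.mp hi
  exact hT hiT

/-- degree bound -/
lemma deg_bound {n : ℕ} {a : Finset (Fin n) → ℝ} (ha : ∀ S, 0 ≤ a S) {z : ℝ} (hz : 0 < z)
    (K : ℕ) {τ : ℝ} (hτ : 0 < τ) (U : Finset (Fin n)) :
    (∑ S, if U ⊆ S ∧ heavy a z K τ S then z ^ (S \ U).card else 0)
      ≤ 2 ^ K * WW a z K U / τ := by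
  rw [le_div_iff₀ hτ, Finset.sum_mul]
  have h1 : ∀ S, (if U ⊆ S ∧ heavy a z K τ S then z ^ (S \ U).card else 0) * τ ≤
      ∑ S', if U ⊆ S' ∧ S'.card ≤ K then (if S ⊆ S' then (z⁻¹) ^ U.card * a S' else 0) else 0 := by
    intro S
    split_ifs with h
    · obtain ⟨hUS, hcard, hW⟩ := h
      calc z ^ (S \ U).card * τ ≤ z ^ (S \ U).card * WW a z K S :=
            mul_le_mul_of_nonneg_left hW (by positivity)
        _ = _ := by
            unfold WW
            have hc : S.card = (S \ U).card + U.card := by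
              rw [Finset.card_sdiff_add_card_eq_card hUS]
            rw [← mul_assoc, hc, pow_add, ← mul_assoc, ← mul_pow, mul_inv_cancel₀ hz.ne',
              one_pow, one_mul, Finset.mul_sum]
            refine Finset.sum_congr rfl fun S' _ => ?_
            by_cases h1 : S ⊆ S'
            · simp [h1, hUS.trans h1]
            · simp [h1]
    · rw [zero_mul]
      exact Finset.sum_nonneg fun S' _ => by
        have := ha S'
        split_ifs <;> positivity
  refine (Finset.sum_le_sum fun S _ => h1 S).trans ?_
  rw [Finset.sum_comm]
  unfold WW
  rw [Finset.mul_sum, Finset.mul_sum]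
  refine Finset.sum_le_sum fun S' _ => ?_
  split_ifs with h
  · rw [← Finset.sum_filter, Finset.sum_const, nsmul_eq_mul]
    have hc : (Finset.univ.filter fun S => S ⊆ S') = S'.powerset := by
      ext; simp
    rw [hc, Finset.card_powerset]
    have := ha S'
    have h2 : ((2 ^ S'.card : ℕ) : ℝ) ≤ 2 ^ K := by
      push_cast
      exact pow_le_pow_right₀ (by norm_num) h.2
    exact mul_le_mul_of_nonneg_right h2 (by positivity)
  · simp

lemma deg_bound2 {n : ℕ} {a : Finset (Fin n) → ℝ} (ha : ∀ S, 0 ≤ a S) {z : ℝ} (hz : 0 < z)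
    (K : ℕ) {τ : ℝ} (hτ : 0 < τ) (V : Finset (Fin n)) (hV : V.card ≤ K)
    (C : Finset (Fin n) → Prop) {w : ℝ} (hw : 0 ≤ w)
    (hW : ∀ U, U ⊆ V → C U → WW a z K U ≤ w) :
    (∑ S, if heavy a z K τ S ∧ C (S ∩ V) then z ^ (S \ V).card else 0)
      ≤ 2 ^ K * (2 ^ K * w / τ) := by
  have h1 : ∀ S, (if heavy a z K τ S ∧ C (S ∩ V) then z ^ (S \ V).card else 0) ≤
      ∑ U ∈ V.powerset, if C U then
        (if U ⊆ S ∧ heavy a z K τ S then z ^ (S \ U).card else 0) else 0 := by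
    intro S
    have hnn : ∀ U ∈ V.powerset, 0 ≤ (if C U then
        (if U ⊆ S ∧ heavy a z K τ S then z ^ (S \ U).card else 0) else 0) := by
      intro U _; split_ifs <;> positivity
    split_ifs with h
    · have := Finset.single_le_sum hnn (a := S ∩ V)
        (Finset.mem_powerset.mpr Finset.inter_subset_right)
      rw [if_pos h.2, if_pos ⟨Finset.inter_subset_left, h.1⟩] at this
      rwa [Finset.sdiff_inter_self_left] at this
    · exact Finset.sum_nonneg hnn
  refine (Finset.sum_le_sum fun S _ => h1 S).trans ?_
  rw [Finset.sum_comm]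
  have h2 : ∀ U ∈ V.powerset, (∑ S, if C U then
        (if U ⊆ S ∧ heavy a z K τ S then z ^ (S \ U).card else 0) else 0) ≤ 2 ^ K * w / τ := by
    intro U hU
    by_cases hC : C U
    · simp only [if_pos hC]
      refine (deg_bound ha hz K hτ U).trans ?_
      have := hW U (Finset.mem_powerset.mp hU) hC
      gcongr
    · simp only [if_neg hC]
      simp; positivity
  refine (Finset.sum_le_sum h2).trans ?_
  rw [Finset.sum_const, nsmul_eq_mul, Finset.card_powerset]
  have h3 : ((2 ^ V.card : ℕ) : ℝ) ≤ 2 ^ K := by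
    push_cast
    exact pow_le_pow_right₀ (by norm_num) hV
  exact mul_le_mul_of_nonneg_right h3 (by positivity)

/-- weighted count of closed sets above `V` -/
def NN {n : ℕ} (H : Finset (Fin n) → Prop) (z : ℝ) (K : ℕ) (V : Finset (Fin n)) : ℝ :=
  ∑ S, if V ⊆ S ∧ S.card ≤ K ∧ MM H S = S then z ^ (S \ V).card else 0

lemma NN_step {n : ℕ} (H : Finset (Fin n) → Prop) {z : ℝ} (hz : 0 < z) (K : ℕ)
    (V : Finset (Fin n)) (G C : Finset (Fin n) → Prop)
    (h : ∀ S, V ⊆ S → MM H S = S → G S → ∃ S1, S1 ⊆ S ∧ H S1 ∧ C S1) :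
    (∑ S, if V ⊆ S ∧ S.card ≤ K ∧ MM H S = S ∧ G S then z ^ (S \ V).card else 0)
      ≤ ∑ S1, if H S1 ∧ C S1 then z ^ (S1 \ V).card * NN H z K (V ∪ S1) else 0 := by
  have h1 : ∀ S, (if V ⊆ S ∧ S.card ≤ K ∧ MM H S = S ∧ G S then z ^ (S \ V).card else 0)
      ≤ ∑ S1, if H S1 ∧ C S1 then z ^ (S1 \ V).card *
        (if V ∪ S1 ⊆ S ∧ S.card ≤ K ∧ MM H S = S then z ^ (S \ (V ∪ S1)).card else 0) else 0 := by
    intro S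
    have hnn : ∀ S1 ∈ Finset.univ, 0 ≤ (if H S1 ∧ C S1 then z ^ (S1 \ V).card *
        (if V ∪ S1 ⊆ S ∧ S.card ≤ K ∧ MM H S = S then z ^ (S \ (V ∪ S1)).card else 0) else 0) := by
      intro S1 _; split_ifs <;> positivity
    split_ifs with hS
    · obtain ⟨hVS, hc, hM, hG⟩ := hS
      obtain ⟨S1, hS1, hH, hC⟩ := h S hVS hM hG
      have := Finset.single_le_sum hnn (Finset.mem_univ S1)
      rw [if_pos ⟨hH, hC⟩, if_pos ⟨Finset.union_subset hVS hS1, hc, hM⟩, ← pow_add] at this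
      have hcard : (S1 \ V).card + (S \ (V ∪ S1)).card = (S \ V).card := by
        rw [← Finset.card_union_of_disjoint]
        · congr 1
          ext j
          simp only [Finset.mem_union, Finset.mem_sdiff]
          constructor
          · rintro (⟨h1, h2⟩ | ⟨h1, h2⟩)
            · exact ⟨hS1 h1, h2⟩
            · exact ⟨h1, fun h => h2 (Or.inl h)⟩
          · rintro ⟨h1, h2⟩
            by_cases h3 : j ∈ S1
            · exact Or.inl ⟨h3, h2⟩
            · exact Or.inr ⟨h1, fun h => h.elim h2 h3⟩
        · rw [Finset.disjoint_left]
          intro j hj hj2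
          simp only [Finset.mem_union, Finset.mem_sdiff] at hj hj2
          exact hj2.2 (Or.inr hj.1)
      rwa [hcard] at this
    · exact Finset.sum_nonneg hnn
  refine (Finset.sum_le_sum fun S _ => h1 S).trans ?_
  rw [Finset.sum_comm]
  refine le_of_eq (Finset.sum_congr rfl fun S1 _ => ?_)
  split_ifs
  · rw [← Finset.mul_sum]; rfl
  · simp

lemma NN_nonneg {n : ℕ} (H : Finset (Fin n) → Prop) {z : ℝ} (hz : 0 < z) (K : ℕ)
    (V : Finset (Fin n)) : 0 ≤ NN H z K V :=
  Finset.sum_nonneg fun S _ => by split_ifs <;> positivity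

lemma NN_bound {n : ℕ} (H : Finset (Fin n) → Prop) {z : ℝ} (hz : 0 < z) (K : ℕ)
    {L : ℝ} (hL : 0 ≤ L)
    (hdeg : ∀ V : Finset (Fin n), V.card ≤ K → (∑ S, if H S then z ^ (S \ V).card else 0) ≤ L)
    (m : ℕ) : ∀ V : Finset (Fin n), K ≤ V.card + m → NN H z K V ≤ (1 + L) ^ m := by
  induction m with
  | zero =>
    intro V hV
    simp only [pow_zero]
    have : NN H z K V ≤ ∑ S, if S = V then 1 else 0 := by
      refine Finset.sum_le_sum fun S _ => ?_
      by_cases hS : S = V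
      · subst hS
        simp only [Finset.sdiff_self, Finset.card_empty, pow_zero, if_true]
        split_ifs <;> norm_num
      · rw [if_neg, if_neg hS]
        rintro ⟨h1, h2, -⟩
        exact hS (Finset.eq_of_subset_of_card_le h1 (by omega)).symm
    refine this.trans ?_
    simp
  | succ m ih =>
    intro V hV
    by_cases hVK : V.card ≤ K
    swap
    · have : NN H z K V = 0 := by
        refine Finset.sum_eq_zero fun S _ => ?_
        rw [if_neg]
        rintro ⟨h1, h2, -⟩
        exact hVK ((Finset.card_le_card h1).trans h2)
      rw [this]; positivity
    have h1 : NN H z K V ≤ 1 + ∑ S, if V ⊆ S ∧ S.card ≤ K ∧ MM H S = S ∧ S ≠ V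
        then z ^ (S \ V).card else 0 := by
      have : (1 : ℝ) = ∑ S : Finset (Fin n), if S = V then 1 else 0 := by simp
      rw [this, ← Finset.sum_add_distrib]
      refine Finset.sum_le_sum fun S _ => ?_
      by_cases hS : S = V
      · subst hS
        simp only [Finset.sdiff_self, Finset.card_empty, pow_zero, if_true]
        split_ifs <;> norm_num
      · simp [hS]
    have h2 : (∑ S, if V ⊆ S ∧ S.card ≤ K ∧ MM H S = S ∧ S ≠ V then z ^ (S \ V).card else 0) ≤
        ∑ S1, if H S1 ∧ ¬ S1 ⊆ V then z ^ (S1 \ V).card * NN H z K (V ∪ S1) else 0 := by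
     convert NN_step H hz K V (fun S => S ≠ V) (fun S1 => ¬ S1 ⊆ V) (by
      intro S hVS hM hne
      by_contra hcon
      push Not at hcon
      apply hne
      refine Finset.Subset.antisymm ?_ hVS
      intro j hj
      rw [← hM] at hj
      obtain ⟨T, hT, hHT, hjT⟩ := mem_MM.mp hj
      exact hcon T hT hHT hjT)
    have h3 : (∑ S1, if H S1 ∧ ¬ S1 ⊆ V then z ^ (S1 \ V).card * NN H z K (V ∪ S1) else 0)
        ≤ (∑ S, if H S then z ^ (S \ V).card else 0) * (1 + L) ^ m := by
      rw [Finset.sum_mul]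
      refine Finset.sum_le_sum fun S1 _ => ?_
      by_cases hH : H S1
      · by_cases hS : S1 ⊆ V
        · simp [hS, hH]; positivity
        · rw [if_pos ⟨hH, hS⟩, if_pos hH]
          refine mul_le_mul_of_nonneg_left (ih _ ?_) (by positivity)
          have : V.card < (V ∪ S1).card := by
            apply Finset.card_lt_card
            refine ⟨Finset.subset_union_left, fun h => hS ?_⟩
            exact Finset.subset_union_right.trans h
          omega
      · simp [hH]
    have h4 := mul_le_mul_of_nonneg_right (hdeg V hVK) (show 0 ≤ (1 + L) ^ m by positivity)
    have h5 : 1 ≤ (1 + L) ^ m := one_le_pow₀ (by linarith)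
    calc NN H z K V ≤ 1 + L * (1 + L) ^ m := by linarith
      _ ≤ (1 + L) ^ m + L * (1 + L) ^ m := by linarith
      _ = (1 + L) ^ (m + 1) := by ring

lemma NN_small {n : ℕ} {a : Finset (Fin n) → ℝ} (ha : ∀ S, 0 ≤ a S) {z : ℝ} (hz : 0 < z)
    (K : ℕ) {τ1 τ2 : ℝ} (hτ1 : 0 < τ1) (hτ2 : 0 < τ2)
    (hW : ∀ U, WW a z K U ≤ 4 ^ K) (V : Finset (Fin n))
    (hV : MM (heavy a z K τ2) V ≠ V) :
    NN (heavy a z K τ1) z K V ≤ (2 ^ K * (2 ^ K * τ2 / τ1)) * (1 + 16 ^ K / τ1) ^ K := by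
  by_cases hVK : V.card ≤ K
  swap
  · have : NN (heavy a z K τ1) z K V = 0 := by
      refine Finset.sum_eq_zero fun S _ => ?_
      rw [if_neg]
      rintro ⟨h1, h2, -⟩
      exact hVK ((Finset.card_le_card h1).trans h2)
    rw [this]; positivity
  obtain ⟨i, hiV, hiM⟩ : ∃ i ∈ V, i ∉ MM (heavy a z K τ2) V := by
    by_contra hcon
    push Not at hcon
    exact hV (Finset.Subset.antisymm (MM_subset _ _) hcon)
  have hdeg : ∀ V : Finset (Fin n), V.card ≤ K →
      (∑ S, if heavy a z K τ1 S then z ^ (S \ V).card else 0) ≤ 16 ^ K / τ1 := by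
    intro V hV
    have := deg_bound2 ha hz K hτ1 V hV (fun _ => True) (w := 4 ^ K) (by positivity)
      (fun U _ _ => hW U)
    simp only [and_true] at this
    refine this.trans (le_of_eq ?_)
    have : (16 : ℝ) ^ K = 2 ^ K * (2 ^ K * 4 ^ K) := by
      rw [← mul_pow, ← mul_pow]; norm_num
    rw [this]; ring
  have hN : ∀ V : Finset (Fin n), NN (heavy a z K τ1) z K V ≤ (1 + 16 ^ K / τ1) ^ K :=
    fun V => NN_bound _ hz K (by positivity) hdeg K V (by omega)
  have h2 := NN_step (heavy a z K τ1) hz K V (fun _ => True) (fun S1 => i ∈ S1) (by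
    intro S hVS hM _
    have hj := hVS hiV
    rw [← hM] at hj
    obtain ⟨T, hT, hHT, hjT⟩ := mem_MM.mp hj
    exact ⟨T, hT, hHT, hjT⟩)
  simp only [and_true] at h2
  refine (show NN (heavy a z K τ1) z K V ≤ _ from h2).trans ?_
  have h3 := deg_bound2 ha hz K hτ1 V hVK (fun U => i ∈ U) (w := τ2) hτ2.le (by
    intro U hU hiU
    by_contra hcon
    push Not at hcon
    exact hiM (mem_MM.mpr ⟨U, hU, ⟨(Finset.card_le_card hU).trans hVK, hcon.le⟩, hiU⟩))
  refine le_trans ?_ (mul_le_mul_of_nonneg_right h3 (by positivity))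
  rw [Finset.sum_mul]
  refine Finset.sum_le_sum fun S1 _ => ?_
  by_cases h : heavy a z K τ1 S1 ∧ i ∈ S1
  · rw [if_pos h, if_pos ⟨h.1, Finset.mem_inter.mpr ⟨h.2, hiV⟩⟩]
    exact mul_le_mul_of_nonneg_left (hN _) (by positivity)
  · rw [if_neg h]
    split_ifs <;> positivity

lemma hat_deriv {n : ℕ} {p s : ℝ} (hs : 1 ≤ s) (hps : p * (1 + s ^ 2) = 1)
    (φ : (Fin n → Bool) → ℝ) (i : Fin n) (S : Finset (Fin n)) (hi : i ∈ S) :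
    hat p s φ S = p * s * hat p s
      (fun x => φ (Function.update x i true) - φ (Function.update x i false)) (S.erase i) := by
  have hs0 : s ≠ 0 := by positivity
  have hq : 1 - p = p * s ^ 2 := by linarith
  unfold hat
  rw [Ex_avg p i, ← Ex_mul]
  congr 1
  funext x
  have h1 : ∀ x, chi s S x = rr s (x i) * chi s (S.erase i) x := by
    intro x
    have := chi_insert s (Finset.notMem_erase i S) x
    rwa [Finset.insert_erase hi] at this
  simp only [h1, chi_update s (Finset.notMem_erase i S), Function.update_self, rr, hq]
  simp
  field_simp
  ring

lemma W_bound_aux {n : ℕ} {p s : ℝ} (hp : 0 < p) (hp1 : p < 1) (hs : 1 ≤ s)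
    (hps : p * (1 + s ^ 2) = 1)
    (U : Finset (Fin n)) : ∀ (φ : (Fin n → Bool) → ℝ) (M : ℝ), (∀ x, |φ x| ≤ M) →
    (s ^ 2) ^ U.card * ∑ S ∈ Finset.univ.filter (fun S => U ⊆ S), hat p s φ S ^ 2
      ≤ 4 ^ U.card * M ^ 2 := by
  induction U using Finset.induction_on with
  | empty =>
    intro φ M hM
    simp only [Finset.card_empty, pow_zero, one_mul, Finset.empty_subset, Finset.filter_true]
    have := plancherel hs hps φ φ
    calc ∑ S, hat p s φ S ^ 2 = Ex p (fun x => φ x * φ x) := by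
          rw [← this]; exact Finset.sum_congr rfl fun S _ => by ring
      _ ≤ Ex p (fun _ => M ^ 2 * 1) := Ex_mono hp hp1 fun x => by
          have := abs_le.mp (hM x)
          nlinarith
      _ = M ^ 2 := by rw [Ex_mul, Ex_one, mul_one]
  | insert i U hi ih =>
    intro φ M hM
    set ψ := fun x : Fin n → Bool =>
      φ (Function.update x i true) - φ (Function.update x i false) with hψ
    have h1 := ih ψ (2 * M) (fun x => by
      have a1 := abs_le.mp (hM (Function.update x i true))
      have a2 := abs_le.mp (hM (Function.update x i false))
      rw [abs_le]; constructor <;> simp only [hψ] <;> linarith)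
    have h2 : ∑ S ∈ Finset.univ.filter (fun S => insert i U ⊆ S), hat p s φ S ^ 2
        ≤ (p * s) ^ 2 * ∑ S ∈ Finset.univ.filter (fun S => U ⊆ S), hat p s ψ S ^ 2 := by
      have e1 : ∀ S ∈ Finset.univ.filter (fun S => insert i U ⊆ S), hat p s φ S ^ 2
          = (p * s) ^ 2 * hat p s ψ (S.erase i) ^ 2 := by
        intro S hS
        rw [hat_deriv hs hps φ i S ((Finset.mem_filter.mp hS).2 (Finset.mem_insert_self _ _))]
        ring
      rw [Finset.sum_congr rfl e1, ← Finset.mul_sum]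
      refine mul_le_mul_of_nonneg_left ?_ (by positivity)
      rw [← Finset.sum_image (f := fun S => hat p s ψ S ^ 2)
        (g := fun S : Finset (Fin n) => S.erase i)]
      · refine Finset.sum_le_sum_of_subset_of_nonneg ?_ (fun S _ _ => by positivity)
        intro S hS
        obtain ⟨S', hS', rfl⟩ := Finset.mem_image.mp hS
        have := (Finset.mem_filter.mp hS').2
        refine Finset.mem_filter.mpr ⟨Finset.mem_univ _, fun j hj => ?_⟩
        exact Finset.mem_erase.mpr ⟨fun h => hi (h ▸ hj), this (Finset.mem_insert_of_mem hj)⟩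
      · intro S hS S' hS' h
        have a1 : i ∈ S := (Finset.mem_filter.mp hS).2 (Finset.mem_insert_self _ _)
        have a2 : i ∈ S' := (Finset.mem_filter.mp hS').2 (Finset.mem_insert_self _ _)
        simp only at h
        rw [← Finset.insert_erase a1, h, Finset.insert_erase a2]
    rw [Finset.card_insert_of_notMem hi]
    have hq : p * s ^ 2 ≤ 1 := by nlinarith
    have hq0 : 0 ≤ p * s ^ 2 := by positivity
    have hnn : 0 ≤ (s ^ 2) ^ U.card *
        ∑ S ∈ Finset.univ.filter (fun S => U ⊆ S), hat p s ψ S ^ 2 :=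
      mul_nonneg (by positivity) (Finset.sum_nonneg fun S _ => by positivity)
    calc (s ^ 2) ^ (U.card + 1) *
          ∑ S ∈ Finset.univ.filter (fun S => insert i U ⊆ S), hat p s φ S ^ 2
        ≤ (s ^ 2) ^ (U.card + 1) *
          ((p * s) ^ 2 * ∑ S ∈ Finset.univ.filter (fun S => U ⊆ S), hat p s ψ S ^ 2) :=
          mul_le_mul_of_nonneg_left h2 (by positivity)
      _ = (p * s ^ 2) ^ 2 * ((s ^ 2) ^ U.card *
          ∑ S ∈ Finset.univ.filter (fun S => U ⊆ S), hat p s ψ S ^ 2) := by ring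
      _ ≤ 1 * ((s ^ 2) ^ U.card *
          ∑ S ∈ Finset.univ.filter (fun S => U ⊆ S), hat p s ψ S ^ 2) :=
          mul_le_mul_of_nonneg_right (by nlinarith) hnn
      _ ≤ 4 ^ U.card * (2 * M) ^ 2 := by rw [one_mul]; exact h1
      _ = 4 ^ (U.card + 1) * M ^ 2 := by ring

lemma W_bound {n : ℕ} {p s : ℝ} (hp : 0 < p) (hp1 : p < 1) (hs : 1 ≤ s)
    (hps : p * (1 + s ^ 2) = 1) (K : ℕ) (φ : (Fin n → Bool) → ℝ) (hφ : ∀ x, |φ x| ≤ 1)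
    (U : Finset (Fin n)) :
    WW (fun S => hat p s φ S ^ 2) (s ^ 2)⁻¹ K U ≤ 4 ^ K := by
  unfold WW
  rw [inv_inv]
  by_cases hU : U.card ≤ K
  · have h := W_bound_aux hp hp1 hs hps U φ 1 hφ
    rw [Finset.sum_filter] at h
    have h4 : (4 : ℝ) ^ U.card ≤ 4 ^ K := pow_le_pow_right₀ (by norm_num) hU
    have : (s ^ 2) ^ U.card * (∑ S, if U ⊆ S ∧ S.card ≤ K then hat p s φ S ^ 2 else 0)
        ≤ (s ^ 2) ^ U.card * ∑ S, if U ⊆ S then hat p s φ S ^ 2 else 0 := by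
      refine mul_le_mul_of_nonneg_left (Finset.sum_le_sum fun S _ => ?_) (by positivity)
      by_cases h1 : U ⊆ S
      · by_cases h2 : S.card ≤ K
        · simp [h1, h2]
        · simp [h1, h2]; positivity
      · simp [h1]
    linarith
  · have : (∑ S, if U ⊆ S ∧ S.card ≤ K then hat p s φ S ^ 2 else 0) = 0 := by
      refine Finset.sum_eq_zero fun S _ => ?_
      rw [if_neg]
      rintro ⟨h1, h2⟩
      exact hU ((Finset.card_le_card h1).trans h2)
    rw [this, mul_zero]; positivity

/-- scalar recursion for coefficients of a function orthogonal to closed cubes -/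
lemma rho_bound {n : ℕ} {w : ℝ} (hw : 0 ≤ w) (ρ : Finset (Fin n) → ℝ)
    (P : Finset (Fin n) → Prop)
    (h : ∀ S, P S → ∑ V ∈ S.powerset, w ^ (S \ V).card * ρ V = 0) (S : Finset (Fin n)) :
    P S → |ρ S| ≤ 2 ^ (S.card ^ 2) *
      ∑ V ∈ S.powerset, if P V then 0 else w ^ (S \ V).card * |ρ V| := by
  induction S using Finset.strongInduction with
  | H S ih =>
  intro hS
  set T := fun S : Finset (Fin n) =>
    ∑ V ∈ S.powerset, if P V then 0 else w ^ (S \ V).card * |ρ V| with hT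
  have hTnn : ∀ S, 0 ≤ T S := fun S => Finset.sum_nonneg fun V _ => by split_ifs <;> positivity
  have h0 := h S hS
  rw [← Finset.insert_erase (Finset.mem_powerset_self S), Finset.sum_insert (by simp)] at h0
  have h1 : |ρ S| ≤ ∑ V ∈ S.powerset.erase S, w ^ (S \ V).card * |ρ V| := by
    have : ρ S = - ∑ V ∈ S.powerset.erase S, w ^ (S \ V).card * ρ V := by
      simp only [Finset.sdiff_self, Finset.card_empty, pow_zero, one_mul] at h0; linarith
    rw [this, abs_neg]
    refine (Finset.abs_sum_le_sum_abs _ _).trans (le_of_eq (Finset.sum_congr rfl fun V _ => ?_))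
    rw [abs_mul, abs_of_nonneg (pow_nonneg hw _)]
  rcases Nat.eq_zero_or_pos S.card with hc | hc
  · have : S = ∅ := Finset.card_eq_zero.mp hc
    subst this
    have h1' : |ρ ∅| ≤ 0 := by simpa using h1
    exact h1'.trans (mul_nonneg (by positivity) (hTnn ∅))
  have h2 : ∀ V ∈ S.powerset.erase S, w ^ (S \ V).card * |ρ V| ≤ 2 ^ ((S.card - 1) ^ 2) * T S := by
    intro V hV
    have hVS : V ⊆ S := Finset.mem_powerset.mp (Finset.mem_of_mem_erase hV)
    have hVss : V ⊂ S := lt_of_le_of_ne hVS (Finset.ne_of_mem_erase hV)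
    have hone : (1 : ℝ) ≤ 2 ^ ((S.card - 1) ^ 2) := one_le_pow₀ (by norm_num)
    by_cases hPV : P V
    · have hle : w ^ (S \ V).card * T V ≤ T S := by
        simp only [hT]
        rw [Finset.mul_sum]
        refine le_trans ?_ (Finset.sum_le_sum_of_subset_of_nonneg
          (Finset.powerset_mono.mpr hVS) (fun V' _ _ => by split_ifs <;> positivity))
        refine Finset.sum_le_sum fun V' hV' => ?_
        split_ifs
        · simp
        · have hV'V : V' ⊆ V := Finset.mem_powerset.mp hV'
          have e : (S \ V').card = (S \ V).card + (V \ V').card := by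
            have a1 := Finset.card_sdiff_add_card_eq_card hVS
            have a2 := Finset.card_sdiff_add_card_eq_card hV'V
            have a3 := Finset.card_sdiff_add_card_eq_card (hV'V.trans hVS)
            omega
          rw [e, pow_add, mul_assoc]
      have hcard : V.card ≤ S.card - 1 := by
        have := Finset.card_lt_card hVss; omega
      calc w ^ (S \ V).card * |ρ V| ≤ w ^ (S \ V).card * (2 ^ (V.card ^ 2) * T V) :=
            mul_le_mul_of_nonneg_left (ih V hVss hPV) (by positivity)
        _ = 2 ^ (V.card ^ 2) * (w ^ (S \ V).card * T V) := by ring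
        _ ≤ 2 ^ ((S.card - 1) ^ 2) * T S := by
            apply mul_le_mul _ hle (mul_nonneg (by positivity) (hTnn V)) (by positivity)
            exact pow_le_pow_right₀ (by norm_num) (Nat.pow_le_pow_left hcard 2)
    · have : w ^ (S \ V).card * |ρ V| ≤ T S := by
        have := Finset.single_le_sum (f := fun V => if P V then 0 else w ^ (S \ V).card * |ρ V|)
          (fun V' _ => by split_ifs <;> positivity) (Finset.mem_powerset.mpr hVS)
        simpa [hPV] using this
      have := hTnn S
      nlinarith
  have h3 := Finset.sum_le_sum h2
  rw [Finset.sum_const, nsmul_eq_mul] at h3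
  refine h1.trans (h3.trans ?_)
  rw [← mul_assoc]
  refine mul_le_mul_of_nonneg_right ?_ (hTnn S)
  have h4 : ((S.powerset.erase S).card : ℝ) ≤ 2 ^ S.card := by
    have := Finset.card_le_card (Finset.erase_subset S S.powerset)
    rw [Finset.card_powerset] at this
    exact_mod_cast this
  calc ((S.powerset.erase S).card : ℝ) * 2 ^ ((S.card - 1) ^ 2)
      ≤ 2 ^ S.card * 2 ^ ((S.card - 1) ^ 2) := mul_le_mul_of_nonneg_right h4 (by positivity)
    _ = 2 ^ (S.card + (S.card - 1) ^ 2) := by rw [pow_add]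
    _ ≤ 2 ^ (S.card ^ 2) := by
        apply pow_le_pow_right₀ (by norm_num)
        obtain ⟨m, hm⟩ : ∃ m, S.card = m + 1 := ⟨S.card - 1, by omega⟩
        rw [hm]; simp; nlinarith

/-- real-valued version of f -/
def FF {n : ℕ} (f : (Fin n → Bool) → Bool) (x : Fin n → Bool) : ℝ := if f x = true then 1 else 0

/-- individual influence -/
def Infl {n : ℕ} (p : ℝ) (f : (Fin n → Bool) → Bool) (i : Fin n) : ℝ :=
  ∑ x : Fin n → Bool, ∑ b : Bool,
    wt p x * (if b then p else 1 - p) *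
      (if f x = f (Function.update x i b) then 0 else 1)

lemma totalInfluence_eq {n : ℕ} (p : ℝ) (f : (Fin n → Bool) → Bool) :
    totalInfluence p f = ∑ i, Infl p f i := rfl

lemma Infl_nonneg {n : ℕ} {p : ℝ} (hp : 0 < p) (hp1 : p < 1) (f : (Fin n → Bool) → Bool)
    (i : Fin n) : 0 ≤ Infl p f i := by
  refine Finset.sum_nonneg fun x _ => Finset.sum_nonneg fun b _ => ?_
  have := wt_pos hp hp1 x
  have : 0 < 1 - p := by linarith
  refine mul_nonneg (mul_nonneg (by positivity) ?_) ?_ <;> split_ifs <;> linarith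

/-- Laplacian -/
def fi {n : ℕ} (p : ℝ) (f : (Fin n → Bool) → Bool) (i : Fin n) (x : Fin n → Bool) : ℝ :=
  FF f x - (p * FF f (Function.update x i true) + (1 - p) * FF f (Function.update x i false))

lemma FF_cases {n : ℕ} (f : (Fin n → Bool) → Bool) (x : Fin n → Bool) :
    FF f x = 0 ∨ FF f x = 1 := by
  unfold FF; split_ifs <;> simp

lemma fi_abs {n : ℕ} {p : ℝ} (hp : 0 < p) (hp1 : p < 1) (f : (Fin n → Bool) → Bool)
    (i : Fin n) (x : Fin n → Bool) : |fi p f i x| ≤ 1 := by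
  unfold fi
  rw [abs_le]
  rcases FF_cases f x with h | h <;> rcases FF_cases f (Function.update x i true) with h1 | h1 <;>
    rcases FF_cases f (Function.update x i false) with h2 | h2 <;> rw [h, h1, h2] <;>
    constructor <;> linarith

lemma Ex_fi {n : ℕ} {p : ℝ} (hp : 0 < p) (hp1 : p < 1) (f : (Fin n → Bool) → Bool)
    (i : Fin n) : Ex p (fun x => |fi p f i x|) ≤ Infl p f i := by
  unfold Ex Infl
  refine Finset.sum_le_sum fun x _ => ?_
  rw [Fintype.sum_bool]
  simp only [mul_assoc]
  rw [← mul_add]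
  refine mul_le_mul_of_nonneg_left ?_ (wt_pos hp hp1 x).le
  unfold fi FF
  rw [abs_le]
  rcases hx : f x <;> rcases h1 : f (Function.update x i true) <;>
    rcases h2 : f (Function.update x i false) <;> simp <;> linarith

lemma hat_fi {n : ℕ} {p s : ℝ} (hs : 1 ≤ s) (hps : p * (1 + s ^ 2) = 1)
    (f : (Fin n → Bool) → Bool) (i : Fin n) (S : Finset (Fin n)) (hi : i ∈ S) :
    hat p s (fi p f i) S = hat p s (FF f) S := by
  have h0 := hat_sub p s (FF f) (fun x => p * FF f (Function.update x i true)
    + (1 - p) * FF f (Function.update x i false)) S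
  rw [hat_indep hs hps (fun x => p * FF f (Function.update x i true)
    + (1 - p) * FF f (Function.update x i false)) i S hi (by intro x b; simp), sub_zero] at h0
  exact h0

lemma infl_mass {n : ℕ} {p s : ℝ} (hp : 0 < p) (hp1 : p < 1) (hs : 1 ≤ s)
    (hps : p * (1 + s ^ 2) = 1) (f : (Fin n → Bool) → Bool) (i : Fin n) :
    (∑ S, if i ∈ S then hat p s (FF f) S ^ 2 else 0) ≤ Infl p f i := by
  calc (∑ S, if i ∈ S then hat p s (FF f) S ^ 2 else 0)
      ≤ ∑ S, hat p s (fi p f i) S * hat p s (fi p f i) S := by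
        refine Finset.sum_le_sum fun S _ => ?_
        split_ifs with h
        · rw [hat_fi hs hps f i S h]; nlinarith
        · nlinarith
    _ = Ex p (fun x => fi p f i x * fi p f i x) := plancherel hs hps _ _
    _ ≤ Ex p (fun x => |fi p f i x|) := by
        refine Ex_mono hp hp1 fun x => ?_
        have := fi_abs hp hp1 f i x
        rw [← abs_mul_abs_self]
        nlinarith [abs_nonneg (fi p f i x)]
    _ ≤ _ := Ex_fi hp hp1 f i

lemma high_mass {n : ℕ} {p s : ℝ} (hp : 0 < p) (hp1 : p < 1) (hs : 1 ≤ s)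
    (hps : p * (1 + s ^ 2) = 1) (f : (Fin n → Bool) → Bool) (K : ℕ) :
    K * (∑ S : Finset (Fin n), if K < S.card then hat p s (FF f) S ^ 2 else 0)
      ≤ totalInfluence p f := by
  rw [totalInfluence_eq]
  refine le_trans ?_ (Finset.sum_le_sum fun i _ => infl_mass hp hp1 hs hps f i)
  rw [Finset.sum_comm, Finset.mul_sum]
  refine Finset.sum_le_sum fun S _ => ?_
  rw [Finset.sum_ite_mem, Finset.univ_inter, Finset.sum_const, nsmul_eq_mul]
  split_ifs with h
  · have : (K : ℝ) ≤ S.card := by exact_mod_cast h.le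
    nlinarith [sq_nonneg (hat p s (FF f) S)]
  · rw [mul_zero]; positivity

lemma Ex_mul_poly {n : ℕ} (p s : ℝ) (φ : (Fin n → Bool) → ℝ) (c : Finset (Fin n) → ℝ) :
    Ex p (fun x => φ x * poly s c Finset.univ x) = ∑ S, c S * hat p s φ S := by
  unfold poly
  simp only [Finset.mul_sum, Finset.powerset_univ]
  rw [Ex_sum]
  refine Finset.sum_congr rfl fun S _ => ?_
  unfold hat
  rw [← Ex_mul]
  congr 1; funext x; ring

lemma alph_sum {n : ℕ} (c : Finset (Fin n) → ℝ) (K : ℕ) (hc : ∀ S, K < S.card → c S = 0) :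
    ∑ U, alph c Finset.univ U ≤ 8 ^ K * ∑ S, c S ^ 2 := by
  unfold alph
  rw [Finset.sum_comm, Finset.mul_sum, Finset.powerset_univ]
  refine Finset.sum_le_sum fun S _ => ?_
  rw [← Finset.sum_filter, Finset.sum_const, nsmul_eq_mul]
  have h1 : (Finset.univ.filter fun U => U ⊆ S) = S.powerset := by ext; simp
  rw [h1, Finset.card_powerset]
  by_cases h : K < S.card
  · simp [hc S h]
  · push Not at h
    have h2 : (8 : ℝ) ^ S.card ≤ 8 ^ K := pow_le_pow_right₀ (by norm_num) h
    have h3 : ((2 ^ S.card : ℕ) : ℝ) * (4 ^ S.card * c S ^ 2) = 8 ^ S.card * c S ^ 2 := by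
      push_cast
      rw [← mul_assoc, ← mul_pow]; norm_num
    rw [h3]
    exact mul_le_mul_of_nonneg_right h2 (sq_nonneg _)

lemma pw_young (a b t : ℝ) (ht : 0 < t) (ha : |a| ≤ 1) :
    a * b ≤ t * |a| + (t⁻¹) ^ 3 * b ^ 4 := by
  have h0 : a * b ≤ |a| * |b| := by rw [← abs_mul]; exact le_abs_self _
  have h4 : b ^ 4 = |b| ^ 4 := by rw [← abs_pow]; exact (abs_of_nonneg (by positivity)).symm
  rw [h4]
  have hb := abs_nonneg b
  have haa := abs_nonneg a
  generalize |b| = B at *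
  generalize |a| = A at *
  by_cases h : B ≤ t
  · have : 0 ≤ (t⁻¹) ^ 3 * B ^ 4 := by positivity
    nlinarith
  · push Not at h
    have h1 : 1 ≤ t⁻¹ * B := by
      rw [inv_mul_eq_div, le_div_iff₀ ht]; linarith
    have h2 : B ≤ (t⁻¹) ^ 3 * B ^ 4 := by
      have : (t⁻¹) ^ 3 * B ^ 4 = (t⁻¹ * B) ^ 3 * B := by ring
      rw [this]
      have := one_le_pow₀ h1 (n := 3)
      nlinarith
    nlinarith [mul_nonneg ht.le haa]

lemma light_one {n : ℕ} {p s : ℝ} (hp : 0 < p) (hp1 : p < 1) (hs : 1 ≤ s)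
    (hps : p * (1 + s ^ 2) = 1) (f : (Fin n → Bool) → Bool) (K : ℕ) (hK : 1 ≤ K) (i : Fin n) :
    (∑ S : Finset (Fin n), if i ∈ S ∧ S.card ≤ K ∧
      i ∉ MM (heavy (fun S => hat p s (FF f) S ^ 2) (s ^ 2)⁻¹ K ((2 ^ (9 * K))⁻¹)) S
      then hat p s (FF f) S ^ 2 else 0) ≤ 2 * ((2 ^ K)⁻¹ * Infl p f i) := by
  have hs0 : 0 < s := by linarith
  obtain ⟨τ, hτ⟩ : ∃ τ : ℝ, τ = (2 ^ (9 * K))⁻¹ := ⟨_, rfl⟩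
  rw [← hτ]
  obtain ⟨a, ha⟩ : ∃ a : Finset (Fin n) → ℝ, a = fun S => hat p s (FF f) S ^ 2 := ⟨_, rfl⟩
  have haS : ∀ S, hat p s (FF f) S ^ 2 = a S := fun S => by rw [ha]
  have ha0 : ∀ S, 0 ≤ a S := fun S => by rw [← haS]; positivity
  rw [← ha]
  obtain ⟨Q, hQ⟩ : ∃ Q : Finset (Fin n) → Prop, ∀ S, Q S ↔ (i ∈ S ∧ S.card ≤ K ∧
      i ∉ MM (heavy a (s ^ 2)⁻¹ K τ) S) := ⟨_, fun S => Iff.rfl⟩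
  simp only [← hQ]
  obtain ⟨c, hc⟩ : ∃ c : Finset (Fin n) → ℝ, c = fun S => if Q S then hat p s (FF f) S else 0 :=
    ⟨_, rfl⟩
  have hcS : ∀ S, c S ^ 2 = if Q S then hat p s (FF f) S ^ 2 else 0 := by
    intro S; rw [hc]; dsimp only; split_ifs <;> simp
  simp only [← hcS]
  have hcK : ∀ S, K < S.card → c S = 0 := by
    intro S h
    rw [hc]; dsimp only
    rw [if_neg]
    intro h'
    have := ((hQ S).mp h').2.1
    omega
  have e1 : ∑ S, c S ^ 2 = Ex p (fun x => fi p f i x * poly s c Finset.univ x) := by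
    rw [Ex_mul_poly]
    refine Finset.sum_congr rfl fun S _ => ?_
    rw [hc]; dsimp only
    split_ifs with h
    · rw [hat_fi hs hps f i S ((hQ S).mp h).1]; ring
    · simp
  have hal : ∀ U, (s ^ 2) ^ U.card * alph c Finset.univ U ≤ 4 ^ K * τ := by
    intro U
    by_cases hU : ∃ S0, Q S0 ∧ U ⊆ S0
    · obtain ⟨S0, hS0, hUS⟩ := hU
      obtain ⟨hi0, hK0, hM0⟩ := (hQ S0).mp hS0
      have hsub : insert i U ⊆ S0 := Finset.insert_subset hi0 hUS
      have hnh : ¬ heavy a (s ^ 2)⁻¹ K τ (insert i U) := by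
        intro h
        exact hM0 (mem_MM.mpr ⟨_, hsub, h, Finset.mem_insert_self _ _⟩)
      have hW : WW a (s ^ 2)⁻¹ K (insert i U) < τ := by
        by_contra h
        push Not at h
        exact hnh ⟨(Finset.card_le_card hsub).trans hK0, h⟩
      have h1 : alph c Finset.univ U ≤ 4 ^ K * ∑ S, if insert i U ⊆ S ∧ S.card ≤ K then a S else 0 := by
        unfold alph
        rw [Finset.mul_sum, Finset.powerset_univ]
        refine Finset.sum_le_sum fun S _ => ?_
        rw [hcS]
        by_cases hq : Q S
        · obtain ⟨h1, h2, h3⟩ := (hQ S).mp hq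
          by_cases hu : U ⊆ S
          · rw [if_pos hu, if_pos hq, if_pos ⟨Finset.insert_subset h1 hu, h2⟩, haS]
            exact mul_le_mul_of_nonneg_right (pow_le_pow_right₀ (by norm_num) h2) (ha0 S)
          · rw [if_neg hu]
            have := ha0 S
            split_ifs <;> positivity
        · rw [if_neg hq, mul_zero, ite_self]
          have := ha0 S
          split_ifs <;> positivity
      unfold WW at hW
      rw [inv_inv] at hW
      have h2 : (s ^ 2) ^ U.card ≤ (s ^ 2) ^ (insert i U).card :=
        pow_le_pow_right₀ (one_le_pow₀ hs) (Finset.card_le_card (Finset.subset_insert _ _))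
      have h3 : 0 ≤ ∑ S, if insert i U ⊆ S ∧ S.card ≤ K then a S else 0 :=
        Finset.sum_nonneg fun S _ => by have := ha0 S; split_ifs <;> simp [this]
      calc (s ^ 2) ^ U.card * alph c Finset.univ U
          ≤ (s ^ 2) ^ (insert i U).card *
            (4 ^ K * ∑ S, if insert i U ⊆ S ∧ S.card ≤ K then a S else 0) :=
            mul_le_mul h2 h1 (alph_nonneg _ _ _) (by positivity)
        _ = 4 ^ K * ((s ^ 2) ^ (insert i U).card *
            ∑ S, if insert i U ⊆ S ∧ S.card ≤ K then a S else 0) := by ring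
        _ ≤ _ := mul_le_mul_of_nonneg_left hW.le (by positivity)
    · push Not at hU
      have : alph c Finset.univ U = 0 := by
        unfold alph
        refine Finset.sum_eq_zero fun S _ => ?_
        split_ifs with h
        · rw [hcS, if_neg (fun hq => hU S hq h), mul_zero]
        · rfl
      rw [this, mul_zero, hτ]
      positivity
  have e2 : Ex p (fun x => poly s c Finset.univ x ^ 4) ≤ 4 ^ K * τ * (8 ^ K * ∑ S, c S ^ 2) := by
    have h := hyper hp hp1 hs hps Finset.univ c c
    have h0 : (fun x => poly s c Finset.univ x ^ 4) =
      fun x => poly s c Finset.univ x ^ 2 * poly s c Finset.univ x ^ 2 := by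
      funext x; ring
    rw [h0]
    refine h.trans ?_
    rw [Finset.powerset_univ]
    have hτ0 : 0 < τ := by rw [hτ]; positivity
    refine le_trans ?_ (mul_le_mul_of_nonneg_left (alph_sum c K hcK) (by positivity))
    rw [Finset.mul_sum]
    refine Finset.sum_le_sum fun U _ => ?_
    rw [← mul_assoc]
    exact mul_le_mul_of_nonneg_right (hal U) (alph_nonneg _ _ _)
  obtain ⟨m, hm⟩ : ∃ m, m = ∑ S, c S ^ 2 := ⟨_, rfl⟩
  have hm0 : 0 ≤ m := by rw [hm]; positivity
  rw [← hm] at e1 e2 ⊢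
  have ht : (0 : ℝ) < (2 ^ K)⁻¹ := by positivity
  have e3 : m ≤ (2 ^ K)⁻¹ * Infl p f i + (((2 ^ K)⁻¹)⁻¹) ^ 3 * (4 ^ K * τ * (8 ^ K * m)) := by
    calc m = _ := e1
      _ ≤ Ex p (fun x => (2 ^ K)⁻¹ * |fi p f i x| +
          (((2 ^ K)⁻¹)⁻¹) ^ 3 * poly s c Finset.univ x ^ 4) :=
        Ex_mono hp hp1 fun x => pw_young _ _ _ ht (fi_abs hp hp1 f i x)
      _ = (2 ^ K)⁻¹ * Ex p (fun x => |fi p f i x|) +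
          (((2 ^ K)⁻¹)⁻¹) ^ 3 * Ex p (fun x => poly s c Finset.univ x ^ 4) := by
        rw [Ex_add, Ex_mul, Ex_mul]
      _ ≤ _ := by
        have := Ex_fi hp hp1 f i
        gcongr
  have e4 : (((2 ^ K)⁻¹ : ℝ)⁻¹) ^ 3 * (4 ^ K * τ * (8 ^ K * m)) = (2 ^ K)⁻¹ * m := by
    have h4 : (4 : ℝ) ^ K = (2 ^ K) ^ 2 := by rw [← pow_mul, mul_comm, pow_mul]; norm_num
    have h8 : (8 : ℝ) ^ K = (2 ^ K) ^ 3 := by rw [← pow_mul, mul_comm, pow_mul]; norm_num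
    have h9 : (2 : ℝ) ^ (9 * K) = (2 ^ K) ^ 9 := by rw [← pow_mul, mul_comm]
    rw [hτ, inv_inv, h4, h8, h9]
    have : (2 : ℝ) ^ K ≠ 0 := by positivity
    field_simp
  rw [e4] at e3
  have e5 : ((2 : ℝ) ^ K)⁻¹ ≤ 1 / 2 := by
    rw [one_div]
    apply inv_anti₀ (by norm_num)
    calc (2 : ℝ) = 2 ^ 1 := by norm_num
      _ ≤ 2 ^ K := pow_le_pow_right₀ (by norm_num) hK
  nlinarith

lemma light_mass {n : ℕ} {p s : ℝ} (hp : 0 < p) (hp1 : p < 1) (hs : 1 ≤ s)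
    (hps : p * (1 + s ^ 2) = 1) (f : (Fin n → Bool) → Bool) (K : ℕ) (hK : 1 ≤ K) :
    (∑ S : Finset (Fin n), if S.card ≤ K ∧
      MM (heavy (fun S => hat p s (FF f) S ^ 2) (s ^ 2)⁻¹ K ((2 ^ (9 * K))⁻¹)) S ≠ S
      then hat p s (FF f) S ^ 2 else 0) ≤ 2 * ((2 ^ K)⁻¹ * totalInfluence p f) := by
  rw [totalInfluence_eq, Finset.mul_sum, Finset.mul_sum]
  refine le_trans ?_ (Finset.sum_le_sum fun i _ => light_one hp hp1 hs hps f K hK i)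
  rw [Finset.sum_comm]
  refine Finset.sum_le_sum fun S _ => ?_
  generalize heavy (fun S => hat p s (FF f) S ^ 2) (s ^ 2)⁻¹ K ((2 ^ (9 * K))⁻¹) = H
  have hnn : ∀ i ∈ (Finset.univ : Finset (Fin n)), 0 ≤ (if i ∈ S ∧ S.card ≤ K ∧ i ∉ MM H S
      then hat p s (FF f) S ^ 2 else 0) := fun i _ => by split_ifs <;> positivity
  by_cases h : S.card ≤ K ∧ MM H S ≠ S
  · rw [if_pos h]
    obtain ⟨i, hiS, hiM⟩ : ∃ i, i ∈ S ∧ i ∉ MM H S := by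
      by_contra hcon
      push Not at hcon
      exact h.2 (Finset.Subset.antisymm (MM_subset H S) hcon)
    refine le_trans ?_ (Finset.single_le_sum hnn (Finset.mem_univ i))
    rw [if_pos ⟨hiS, h.1, hiM⟩]
  · rw [if_neg h]
    exact Finset.sum_nonneg hnn

/-- conditional expectation given `J` -/
def condE {n : ℕ} (p : ℝ) (J : (Fin n → Bool) → Finset (Fin n)) (φ : (Fin n → Bool) → ℝ)
    (x : Fin n → Bool) : ℝ :=
  Ex p (fun y => if J y = J x then φ y else 0) / Ex p (fun y => if J y = J x then 1 else 0)

lemma atom_pos {n : ℕ} {p : ℝ} (hp : 0 < p) (hp1 : p < 1)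
    (J : (Fin n → Bool) → Finset (Fin n)) (x : Fin n → Bool) :
    0 < Ex p (fun y => if J y = J x then 1 else 0) := by
  unfold Ex
  refine Finset.sum_pos' (fun y _ => ?_) ⟨x, Finset.mem_univ _, ?_⟩
  · have := wt_pos hp hp1 y
    dsimp only
    split_ifs <;> simp [this.le]
  · dsimp only; rw [if_pos rfl, mul_one]; exact wt_pos hp hp1 x

lemma condE_orth {n : ℕ} {p : ℝ} (hp : 0 < p) (hp1 : p < 1)
    (J : (Fin n → Bool) → Finset (Fin n)) (φ : (Fin n → Bool) → ℝ) (g : Finset (Fin n) → ℝ) :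
    Ex p (fun x => g (J x) * (φ x - condE p J φ x)) = 0 := by
  have h0 : (fun x => g (J x) * (φ x - condE p J φ x))
      = fun x => g (J x) * φ x - g (J x) * condE p J φ x := by funext x; ring
  rw [h0, Ex_sub, sub_eq_zero]
  symm
  have h1 : Ex p (fun x => g (J x) * condE p J φ x) = ∑ x, ∑ y, wt p y * φ y *
      (wt p x * g (J x) * (if J y = J x then (Ex p (fun y => if J y = J x then 1 else 0))⁻¹ else 0)) := by
    refine Finset.sum_congr rfl fun x _ => ?_
    show wt p x * (g (J x) * (Ex p (fun y => if J y = J x then φ y else 0) /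
      Ex p (fun y => if J y = J x then 1 else 0))) = _
    rw [div_eq_mul_inv]
    generalize (Ex p (fun y => if J y = J x then (1 : ℝ) else 0))⁻¹ = q
    unfold Ex
    rw [Finset.sum_mul, Finset.mul_sum, Finset.mul_sum]
    refine Finset.sum_congr rfl fun y _ => ?_
    dsimp only
    split_ifs <;> ring
  rw [h1, Finset.sum_comm]
  unfold Ex
  refine Finset.sum_congr rfl fun y _ => ?_
  rw [← Finset.mul_sum]
  have h2 : ∀ x, wt p x * g (J x) * (if J y = J x then
      (∑ y, wt p y * (if J y = J x then (1 : ℝ) else 0))⁻¹ else 0)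
      = (g (J y) * (∑ x, wt p x * (if J x = J y then (1 : ℝ) else 0))⁻¹) *
        (wt p x * (if J x = J y then 1 else 0)) := by
    intro x
    by_cases h : J y = J x
    · rw [if_pos h, if_pos h.symm, h]; ring
    · rw [if_neg h, if_neg (fun h' => h h'.symm)]; ring
  simp only [h2]
  rw [← Finset.mul_sum, mul_assoc (g (J y)), inv_mul_cancel₀]
  · ring
  · exact (atom_pos hp hp1 J y).ne'

lemma condE_J {n : ℕ} (p : ℝ) (J : (Fin n → Bool) → Finset (Fin n)) (φ : (Fin n → Bool) → ℝ) :
    ∃ g : Finset (Fin n) → ℝ, ∀ x, condE p J φ x = g (J x) :=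
  ⟨fun A => Ex p (fun y => if J y = A then φ y else 0) / Ex p (fun y => if J y = A then 1 else 0),
    fun _ => rfl⟩

lemma condE_nonneg {n : ℕ} {p : ℝ} (hp : 0 < p) (hp1 : p < 1)
    (J : (Fin n → Bool) → Finset (Fin n)) (φ : (Fin n → Bool) → ℝ) (hφ : ∀ x, 0 ≤ φ x)
    (x : Fin n → Bool) : 0 ≤ condE p J φ x := by
  unfold condE
  refine div_nonneg ?_ (atom_pos hp hp1 J x).le
  unfold Ex
  refine Finset.sum_nonneg fun y _ => ?_
  have := wt_pos hp hp1 y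
  have := hφ y
  dsimp only
  split_ifs <;> positivity

lemma nu_eq {n : ℕ} {p : ℝ} (hp : 0 < p) (hp1 : p < 1)
    (J : (Fin n → Bool) → Finset (Fin n)) (φ : (Fin n → Bool) → ℝ) :
    Ex p (fun x => φ x * (φ x - condE p J φ x)) =
      Ex p (fun x => (φ x - condE p J φ x) * (φ x - condE p J φ x)) := by
  obtain ⟨g, hg⟩ := condE_J p J φ
  have h := condE_orth hp hp1 J φ g
  rw [← sub_eq_zero, ← Ex_sub, ← h]
  congr 1
  funext x
  rw [← hg]; ring

/-- set of ones -/
def ones {n : ℕ} (x : Fin n → Bool) : Finset (Fin n) := Finset.univ.filter fun i => x i = true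

lemma mem_ones {n : ℕ} {x : Fin n → Bool} {i : Fin n} : i ∈ ones x ↔ x i = true := by
  simp [ones]

lemma MM_mono {n : ℕ} (H : Finset (Fin n) → Prop) {S S' : Finset (Fin n)} (h : S ⊆ S') :
    MM H S ⊆ MM H S' := by
  intro i hi
  obtain ⟨T, hT, hH, hiT⟩ := mem_MM.mp hi
  exact mem_MM.mpr ⟨T, hT.trans h, hH, hiT⟩

lemma chi_expand {n : ℕ} {s : ℝ} (S : Finset (Fin n)) (x : Fin n → Bool) :
    ∑ V ∈ S.powerset, s⁻¹ ^ (S \ V).card * chi s V x =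
      if S ⊆ ones x then (s + s⁻¹) ^ S.card else 0 := by
  have h := Finset.prod_add (fun i => rr s (x i)) (fun _ => s⁻¹) S
  have h1 : ∑ V ∈ S.powerset, s⁻¹ ^ (S \ V).card * chi s V x = ∏ i ∈ S, (rr s (x i) + s⁻¹) := by
    rw [h]
    refine Finset.sum_congr rfl fun V _ => ?_
    rw [Finset.prod_const, mul_comm]; rfl
  rw [h1]
  split_ifs with hS
  · rw [← Finset.prod_const]
    refine Finset.prod_congr rfl fun i hi => ?_
    rw [mem_ones.mp (hS hi)]; simp [rr]
  · obtain ⟨i, hi, hx⟩ := Finset.not_subset.mp hS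
    rw [mem_ones] at hx
    refine Finset.prod_eq_zero hi ?_
    simp [rr, hx]

lemma R_vanish {n : ℕ} {p s : ℝ} (hp : 0 < p) (hp1 : p < 1)
    (H : Finset (Fin n) → Prop) (φ : (Fin n → Bool) → ℝ) (S : Finset (Fin n)) (hS : MM H S = S) :
    ∑ V ∈ S.powerset, s⁻¹ ^ (S \ V).card *
      hat p s (fun x => φ x - condE p (fun x => MM H (ones x)) φ x) V = 0 := by
  have h := condE_orth hp hp1 (fun x => MM H (ones x)) φ
    (fun A => if S ⊆ A then (s + s⁻¹) ^ S.card else 0)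
  rw [← h]
  unfold hat
  have h2 : ∀ V, s⁻¹ ^ (S \ V).card * Ex p (fun x => (φ x - condE p (fun x => MM H (ones x)) φ x)
      * chi s V x) = Ex p (fun x => s⁻¹ ^ (S \ V).card *
        ((φ x - condE p (fun x => MM H (ones x)) φ x) * chi s V x)) := fun V => (Ex_mul _ _ _).symm
  simp only [h2]
  rw [← Ex_sum]
  congr 1
  funext x
  have h3 : (S ⊆ MM H (ones x)) ↔ S ⊆ ones x := by
    constructor
    · exact fun h => h.trans (MM_subset _ _)
    · intro h
      rw [← hS]
      exact MM_mono H h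
  simp only [h3]
  rw [← chi_expand, Finset.sum_mul]
  exact Finset.sum_congr rfl fun V _ => by ring

lemma third {n : ℕ} (K : ℕ) (A R : Finset (Fin n) → ℝ) (P1 P2 : Finset (Fin n) → Prop)
    {w D η : ℝ} (hw : 0 ≤ w) (hη : 0 < η)
    (hR : ∀ S, P2 S → |R S| ≤ 2 ^ (S.card ^ 2) *
      ∑ V ∈ S.powerset, if P2 V then 0 else w ^ (S \ V).card * |R V|)
    (h12 : ∀ S, P1 S → P2 S)
    (hD : ∀ V, ¬ P2 V → (∑ S, if V ⊆ S ∧ S.card ≤ K ∧ P1 S then (w ^ 2) ^ (S \ V).card else 0) ≤ D) :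
    (∑ S, if S.card ≤ K ∧ P1 S then A S * R S else 0) ≤
      η * 2 ^ K * ∑ S, A S ^ 2 + η⁻¹ * (2 ^ (K ^ 2)) ^ 2 * D * ∑ V, R V ^ 2 := by
  have h1 : ∀ S, (if S.card ≤ K ∧ P1 S then A S * R S else 0) ≤
      η * 2 ^ K * A S ^ 2 + ∑ V, if ¬ P2 V then (if V ⊆ S ∧ S.card ≤ K ∧ P1 S then
        (η⁻¹ * (2 ^ (K ^ 2)) ^ 2 * R V ^ 2) * (w ^ 2) ^ (S \ V).card else 0) else 0 := by
    intro S
    by_cases hS : S.card ≤ K ∧ P1 S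
    · rw [if_pos hS]
      have hb := hR S (h12 S hS.2)
      have hpow : (2 : ℝ) ^ (S.card ^ 2) ≤ 2 ^ (K ^ 2) :=
        pow_le_pow_right₀ (by norm_num) (Nat.pow_le_pow_left hS.1 2)
      calc A S * R S ≤ |A S| * |R S| := by rw [← abs_mul]; exact le_abs_self _
        _ ≤ |A S| * (2 ^ (K ^ 2) * ∑ V ∈ S.powerset, if P2 V then 0 else w ^ (S \ V).card * |R V|) := by
          refine mul_le_mul_of_nonneg_left (hb.trans ?_) (abs_nonneg _)
          refine mul_le_mul_of_nonneg_right hpow (Finset.sum_nonneg fun V _ => ?_)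
          split_ifs <;> positivity
        _ = ∑ V ∈ S.powerset, if P2 V then 0 else
            |A S| * (2 ^ (K ^ 2) * (w ^ (S \ V).card * |R V|)) := by
          rw [Finset.mul_sum, Finset.mul_sum]
          exact Finset.sum_congr rfl fun V _ => by split_ifs <;> simp
        _ ≤ ∑ V ∈ S.powerset, (η * A S ^ 2 + if ¬ P2 V then
            (η⁻¹ * (2 ^ (K ^ 2)) ^ 2 * R V ^ 2) * (w ^ 2) ^ (S \ V).card else 0) := by
          refine Finset.sum_le_sum fun V _ => ?_
          by_cases hV : P2 V
          · rw [if_pos hV, if_neg (not_not.mpr hV), add_zero]; positivity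
          · rw [if_neg hV, if_pos hV]
            have e : (η⁻¹ * (2 ^ (K ^ 2)) ^ 2 * R V ^ 2) * (w ^ 2) ^ (S \ V).card
              = η⁻¹ * (2 ^ (K ^ 2) * (w ^ (S \ V).card * |R V|)) ^ 2 := by
              rw [mul_pow, mul_pow, sq_abs, ← pow_mul w, ← pow_mul w, mul_comm 2 (S \ V).card]; ring
            rw [e, ← sq_abs (A S)]
            generalize 2 ^ (K ^ 2) * (w ^ (S \ V).card * |R V|) = B
            generalize |A S| = C
            have : 0 ≤ η⁻¹ * (η * C - B) ^ 2 := by positivity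
            have e2 : η⁻¹ * (η * C - B) ^ 2 = η * C ^ 2 - 2 * (C * B) + η⁻¹ * B ^ 2 := by
              field_simp; ring
            rw [e2] at this
            have h3 : 0 ≤ η * C ^ 2 + η⁻¹ * B ^ 2 := by positivity
            linarith
        _ = η * 2 ^ S.card * A S ^ 2 + ∑ V ∈ S.powerset, if ¬ P2 V then
            (η⁻¹ * (2 ^ (K ^ 2)) ^ 2 * R V ^ 2) * (w ^ 2) ^ (S \ V).card else 0 := by
          rw [Finset.sum_add_distrib, Finset.sum_const, Finset.card_powerset, nsmul_eq_mul]
          push_cast; ring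
        _ ≤ _ := by
          refine add_le_add ?_ ?_
          · have : (2 : ℝ) ^ S.card ≤ 2 ^ K := pow_le_pow_right₀ (by norm_num) hS.1
            gcongr
          · have hp : S.powerset = Finset.univ.filter (fun V => V ⊆ S) := by ext; simp
            rw [hp, Finset.sum_filter]
            refine Finset.sum_le_sum fun V _ => ?_
            by_cases hV : P2 V
            · simp [hV]
            · by_cases hVS : V ⊆ S
              · simp [hV, hVS, hS]
              · simp [hV, hVS]
    · rw [if_neg hS]
      refine add_nonneg (by positivity) (Finset.sum_nonneg fun V _ => ?_)
      split_ifs <;> positivity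
  refine (Finset.sum_le_sum fun S _ => h1 S).trans ?_
  rw [Finset.sum_add_distrib, ← Finset.mul_sum, Finset.sum_comm]
  refine add_le_add_right ?_ _
  rw [Finset.mul_sum]
  refine Finset.sum_le_sum fun V _ => ?_
  have hnn : ∀ V : Finset (Fin n), 0 ≤ ∑ S, if V ⊆ S ∧ S.card ≤ K ∧ P1 S then (w ^ 2) ^ (S \ V).card else 0 :=
    fun V => Finset.sum_nonneg fun S _ => by split_ifs <;> positivity
  by_cases hV : P2 V
  · simp only [hV, not_true_eq_false, if_false, Finset.sum_const_zero]
    by_cases hex : ∃ V, ¬ P2 V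
    · obtain ⟨V', hV'⟩ := hex
      have : 0 ≤ D := (hnn V').trans (hD V' hV')
      positivity
    · push Not at hex
      have : R V = 0 := by
        have := hR V hV
        simp only [hex, if_true, Finset.sum_const_zero, mul_zero] at this
        exact abs_eq_zero.mp (le_antisymm this (abs_nonneg _))
      rw [this]; simp
  · simp only [hV, not_false_eq_true, if_true]
    have := hD V hV
    calc _ = (η⁻¹ * (2 ^ (K ^ 2)) ^ 2 * R V ^ 2) *
        ∑ S, (if V ⊆ S ∧ S.card ≤ K ∧ P1 S then (w ^ 2) ^ (S \ V).card else 0) := by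
          rw [Finset.mul_sum]
          exact Finset.sum_congr rfl fun S _ => by split_ifs <;> simp
      _ ≤ (η⁻¹ * (2 ^ (K ^ 2)) ^ 2 * R V ^ 2) * D :=
          mul_le_mul_of_nonneg_left this (by positivity)
      _ = _ := by ring

lemma FF_abs {n : ℕ} (f : (Fin n → Bool) → Bool) (x : Fin n → Bool) : |FF f x| ≤ 1 := by
  rcases FF_cases f x with h | h <;> simp [h]

lemma FF_nonneg {n : ℕ} (f : (Fin n → Bool) → Bool) (x : Fin n → Bool) : 0 ≤ FF f x := by
  rcases FF_cases f x with h | h <;> simp [h]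

lemma num1 (K : ℕ) (hK : 1 ≤ K) :
    (((2 : ℝ) ^ (2 * K))⁻¹)⁻¹ * (2 ^ (K ^ 2)) ^ 2 *
      ((2 ^ K * (2 ^ K * (2 ^ (30 * K ^ 2))⁻¹ / (2 ^ (9 * K))⁻¹)) *
        (1 + 16 ^ K / (2 ^ (9 * K))⁻¹) ^ K) ≤ (2 ^ K)⁻¹ := by
  have h1 : (1 + 16 ^ K / (2 ^ (9 * K))⁻¹ : ℝ) ≤ 2 ^ (14 * K) := by
    have e : (16 ^ K / (2 ^ (9 * K))⁻¹ : ℝ) = 2 ^ (13 * K) := by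
      rw [div_inv_eq_mul, show (16 : ℝ) = 2 ^ 4 by norm_num, ← pow_mul, ← pow_add]
      congr 1; ring
    rw [e]
    have h2 : (1 : ℝ) ≤ 2 ^ (13 * K) := one_le_pow₀ (by norm_num)
    have h3 : (2 : ℝ) ^ (13 * K) * 2 ≤ 2 ^ (14 * K) := by
      rw [← pow_succ]
      exact pow_le_pow_right₀ (by norm_num) (by omega)
    linarith
  have h2 : (1 + 16 ^ K / (2 ^ (9 * K))⁻¹ : ℝ) ^ K ≤ 2 ^ (14 * K ^ 2) := by
    calc _ ≤ ((2 : ℝ) ^ (14 * K)) ^ K := by gcongr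
      _ = _ := by rw [← pow_mul]; congr 1; ring
  have h3 : (((2 : ℝ) ^ (2 * K))⁻¹)⁻¹ * (2 ^ (K ^ 2)) ^ 2 *
      ((2 ^ K * (2 ^ K * (2 ^ (30 * K ^ 2))⁻¹ / (2 ^ (9 * K))⁻¹)) * 2 ^ (14 * K ^ 2)) ≤ (2 ^ K)⁻¹ := by
    have e : (((2 : ℝ) ^ (2 * K))⁻¹)⁻¹ * (2 ^ (K ^ 2)) ^ 2 *
      ((2 ^ K * (2 ^ K * (2 ^ (30 * K ^ 2))⁻¹ / (2 ^ (9 * K))⁻¹)) * 2 ^ (14 * K ^ 2))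
      = 2 ^ (13 * K + 16 * K ^ 2) / 2 ^ (30 * K ^ 2) := by
      rw [inv_inv, div_inv_eq_mul, pow_add, div_eq_mul_inv]
      have : (2 : ℝ) ^ (13 * K) * 2 ^ (16 * K ^ 2) =
        2 ^ (2 * K) * (2 ^ (K ^ 2)) ^ 2 * (2 ^ K * (2 ^ K * 2 ^ (9 * K)) * 2 ^ (14 * K ^ 2)) := by
        simp only [← pow_add, ← pow_mul]
        congr 1; ring
      rw [this]; ring
    rw [e, div_le_iff₀ (by positivity), inv_mul_eq_div, le_div_iff₀ (by positivity), ← pow_add]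
    exact pow_le_pow_right₀ (by norm_num) (by nlinarith)
  refine le_trans ?_ h3
  gcongr

lemma two_pow_inv_le (K : ℕ) (hK : 1 ≤ K) : ((2 : ℝ) ^ K)⁻¹ ≤ 1 / K := by
  rw [one_div]
  apply inv_anti₀
  · exact_mod_cast hK
  · exact_mod_cast (Nat.lt_two_pow_self (n := K)).le

lemma main_nu {n : ℕ} {p s : ℝ} (hp : 0 < p) (hp1 : p < 1) (hs : 1 ≤ s)
    (hps : p * (1 + s ^ 2) = 1) (f : (Fin n → Bool) → Bool) (K : ℕ) (hK : 1 ≤ K)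
    (J : (Fin n → Bool) → Finset (Fin n))
    (hJ : J = fun x => MM (heavy (fun S => hat p s (FF f) S ^ 2) (s ^ 2)⁻¹ K
      ((2 ^ (30 * K ^ 2))⁻¹)) (ones x)) :
    3 / 4 * Ex p (fun x => FF f x * (FF f x - condE p J (FF f) x)) ≤
      (3 * totalInfluence p f + 2) / K := by
  have hs0 : 0 < s := by linarith
  obtain ⟨ν, hν⟩ : ∃ ν, ν = Ex p (fun x => FF f x * (FF f x - condE p J (FF f) x)) := ⟨_, rfl⟩
  rw [← hν]
  obtain ⟨A, hA⟩ : ∃ A, A = hat p s (FF f) := ⟨_, rfl⟩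
  obtain ⟨R, hR⟩ : ∃ R, R = hat p s (fun x => FF f x - condE p J (FF f) x) := ⟨_, rfl⟩
  have hAA : ∑ S, A S ^ 2 ≤ 1 := by
    have h := plancherel hs hps (FF f) (FF f)
    calc ∑ S, A S ^ 2 = ∑ S, hat p s (FF f) S * hat p s (FF f) S := by
          rw [hA]; exact Finset.sum_congr rfl fun S _ => sq _
      _ ≤ Ex p (fun _ => 1) := by
          rw [h]
          refine Ex_mono hp hp1 fun x => ?_
          rcases FF_cases f x with h | h <;> simp [h]
      _ = 1 := Ex_one p
  have hRR : ∑ S, R S ^ 2 = ν := by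
    rw [hν, nu_eq hp hp1, ← plancherel hs hps, hR]
    exact Finset.sum_congr rfl fun S _ => sq _
  have hAR : ∑ S, A S * R S = ν := by
    rw [hν, ← plancherel hs hps, hR, hA]
  have hν1 : ν ≤ 1 := by
    rw [hν, ← Ex_one (n := n) p]
    refine Ex_mono hp hp1 fun x => ?_
    have := condE_nonneg hp hp1 J (FF f) (FF_nonneg f) x
    rcases FF_cases f x with h | h <;> rw [h] <;> linarith
  obtain ⟨P1, hP1⟩ : ∃ P1 : Finset (Fin n) → Prop, ∀ S, P1 S ↔
    MM (heavy (fun S => hat p s (FF f) S ^ 2) (s ^ 2)⁻¹ K ((2 ^ (9 * K))⁻¹)) S = S :=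
    ⟨_, fun S => Iff.rfl⟩
  obtain ⟨P2, hP2⟩ : ∃ P2 : Finset (Fin n) → Prop, ∀ S, P2 S ↔
    MM (heavy (fun S => hat p s (FF f) S ^ 2) (s ^ 2)⁻¹ K ((2 ^ (30 * K ^ 2))⁻¹)) S = S :=
    ⟨_, fun S => Iff.rfl⟩
  have h12 : ∀ S, P1 S → P2 S := by
    intro S h
    rw [hP1] at h
    rw [hP2]
    refine Finset.Subset.antisymm (MM_subset _ _) ?_
    intro i hi
    rw [← h] at hi
    obtain ⟨T, hT, hH, hiT⟩ := mem_MM.mp hi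
    refine mem_MM.mpr ⟨T, hT, ⟨hH.1, le_trans ?_ hH.2⟩, hiT⟩
    apply inv_anti₀ (by positivity)
    exact pow_le_pow_right₀ (by norm_num) (by nlinarith)
  have t3 := third K A R P1 P2 (w := s⁻¹) (η := ((2 : ℝ) ^ (2 * K))⁻¹)
    (D := (2 ^ K * (2 ^ K * (2 ^ (30 * K ^ 2))⁻¹ / (2 ^ (9 * K))⁻¹)) *
        (1 + 16 ^ K / (2 ^ (9 * K))⁻¹) ^ K) (by positivity) (by positivity)
    (by
      refine rho_bound (by positivity) R P2 ?_
      intro S hS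
      rw [hP2] at hS
      rw [hR, hJ]
      exact R_vanish hp hp1 _ _ S hS)
    h12
    (by
      intro V hV
      rw [hP2] at hV
      have h := NN_small (a := fun S => hat p s (FF f) S ^ 2) (fun S => sq_nonneg _)
        (z := (s ^ 2)⁻¹) (by positivity) K (τ1 := (2 ^ (9 * K))⁻¹) (by positivity)
        (by positivity) (W_bound hp hp1 hs hps K (FF f) (FF_abs f)) V hV
      refine le_trans (le_of_eq ?_) h
      unfold NN
      refine Finset.sum_congr rfl fun S _ => ?_
      simp only [hP1, inv_pow])
  have t1 := high_mass hp hp1 hs hps f K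
  have t2 := light_mass hp hp1 hs hps f K hK
  rw [← hA] at t1 t2
  have hI : 0 ≤ totalInfluence p f := by
    rw [totalInfluence_eq]
    exact Finset.sum_nonneg fun i _ => Infl_nonneg hp hp1 f i
  have hKr : (0 : ℝ) < K := by exact_mod_cast hK
  have h2K := two_pow_inv_le K hK
  have hsplit : ν ≤ (∑ S : Finset (Fin n), if K < S.card then A S ^ 2 else 0)
      + (∑ S : Finset (Fin n), if S.card ≤ K ∧ ¬ P1 S then A S ^ 2 else 0)
      + (∑ S : Finset (Fin n), if S.card ≤ K ∧ P1 S then A S * R S else 0) + 1 / 4 * ν := by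
    nth_rewrite 2 [← hRR]
    rw [← hAR, Finset.mul_sum, ← Finset.sum_add_distrib, ← Finset.sum_add_distrib,
      ← Finset.sum_add_distrib]
    refine Finset.sum_le_sum fun S _ => ?_
    have hq : A S * R S ≤ A S ^ 2 + 1 / 4 * R S ^ 2 := by nlinarith [sq_nonneg (A S - 1 / 2 * R S)]
    have hq2 : 0 ≤ 1 / 4 * R S ^ 2 := by positivity
    by_cases hc : K < S.card
    · rw [if_pos hc, if_neg (by omega), if_neg (by omega)]; linarith
    · by_cases h : P1 S
      · rw [if_neg hc, if_neg (by tauto), if_pos ⟨by omega, h⟩]; linarith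
      · rw [if_neg hc, if_pos ⟨by omega, h⟩, if_neg (by tauto)]; linarith
  have t2' : (∑ S : Finset (Fin n), if S.card ≤ K ∧ ¬ P1 S then A S ^ 2 else 0)
      ≤ 2 * ((2 ^ K)⁻¹ * totalInfluence p f) := by
    refine le_trans (le_of_eq ?_) t2
    refine Finset.sum_congr rfl fun S _ => ?_
    simp only [hP1, hA, ne_eq]
  have t1' : (∑ S : Finset (Fin n), if K < S.card then A S ^ 2 else 0) ≤ totalInfluence p f / K := by
    rw [le_div_iff₀ hKr]; linarith
  have t3' : (∑ S : Finset (Fin n), if S.card ≤ K ∧ P1 S then A S * R S else 0) ≤ 2 * (2 ^ K)⁻¹ := by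
    refine t3.trans ?_
    rw [hRR]
    have e1 : ((2 : ℝ) ^ (2 * K))⁻¹ * 2 ^ K = (2 ^ K)⁻¹ := by
      rw [two_mul, pow_add]; field_simp
    have e2 : ((2 : ℝ) ^ (2 * K))⁻¹ * 2 ^ K * ∑ S, A S ^ 2 ≤ (2 ^ K)⁻¹ := by
      rw [e1]
      exact mul_le_of_le_one_right (by positivity) hAA
    have e3 := num1 K hK
    have hν0 : 0 ≤ ν := by rw [← hRR]; positivity
    have e4 := mul_le_of_le_one_right (a := (((2 : ℝ) ^ (2 * K))⁻¹)⁻¹ * (2 ^ (K ^ 2)) ^ 2 *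
      ((2 ^ K * (2 ^ K * (2 ^ (30 * K ^ 2))⁻¹ / (2 ^ (9 * K))⁻¹)) *
        (1 + 16 ^ K / (2 ^ (9 * K))⁻¹) ^ K)) (by positivity) hν1
    linarith
  have t4 : 2 * ((2 ^ K)⁻¹ * totalInfluence p f) ≤ 2 * (1 / K * totalInfluence p f) := by gcongr
  have t5 : (3 * totalInfluence p f + 2) / K = totalInfluence p f / K +
    2 * (1 / K * totalInfluence p f) + 2 * (1 / K) := by field_simp; ring
  rw [t5]
  linarith

lemma Ex_ones {n : ℕ} (p : ℝ) (S : Finset (Fin n)) :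
    Ex p (fun x => if S ⊆ ones x then 1 else 0) = p ^ S.card := by
  induction S using Finset.induction_on with
  | empty => simp [Ex_one]
  | insert i S hi ih =>
    rw [Finset.card_insert_of_notMem hi, pow_succ, ← ih]
    have h := Ex_indep p i (fun b => if b then 1 else 0) (fun x => if S ⊆ ones x then 1 else 0)
      (by
        intro x b
        have : S ⊆ ones (Function.update x i b) ↔ S ⊆ ones x := by
          simp only [Finset.subset_iff, mem_ones]
          refine forall₂_congr fun j hj => ?_
          rw [Function.update_of_ne (by rintro rfl; exact hi hj)]
        simp only [this])
    simp only [if_true, mul_one, Bool.false_eq_true, if_false, mul_zero, add_zero] at h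
    rw [mul_comm, ← h]
    congr 1
    funext x
    by_cases hx : x i = true <;> simp [Finset.insert_subset_iff, mem_ones, hx]

lemma card_MM_le {n : ℕ} (H : Finset (Fin n) → Prop) (S : Finset (Fin n)) :
    ((MM H S).card : ℝ) ≤ ∑ T, if H T ∧ T ⊆ S then (T.card : ℝ) else 0 := by
  have h : (MM H S).card ≤ ∑ T ∈ S.powerset.filter H, T.card := by
    unfold MM; exact Finset.card_biUnion_le
  have h' : ((MM H S).card : ℝ) ≤ ∑ T ∈ S.powerset.filter H, (T.card : ℝ) := by exact_mod_cast h
  refine h'.trans (le_of_eq ?_)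
  rw [← Finset.sum_filter]
  refine Finset.sum_congr ?_ fun _ _ => rfl
  ext T; simp [and_comm]

lemma Ex_card_J {n : ℕ} {p s : ℝ} (hp : 0 < p) (hp1 : p < 1) (hs : 1 ≤ s)
    (hps : p * (1 + s ^ 2) = 1) (f : (Fin n → Bool) → Bool) (K : ℕ) (τ : ℝ) (hτ : 0 < τ) :
    Ex p (fun x => ((MM (heavy (fun S => hat p s (FF f) S ^ 2) (s ^ 2)⁻¹ K τ) (ones x)).card : ℝ))
      ≤ K * (2 ^ K * 4 ^ K / τ) := by
  have hs0 : 0 < s := by linarith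
  obtain ⟨a, ha⟩ : ∃ a : Finset (Fin n) → ℝ, a = fun S => hat p s (FF f) S ^ 2 := ⟨_, rfl⟩
  have hW : WW a (s ^ 2)⁻¹ K ∅ ≤ 4 ^ K := by
    rw [ha]; exact W_bound hp hp1 hs hps K (FF f) (FF_abs f) ∅
  rw [← ha]
  have ha0 : ∀ S, 0 ≤ a S := fun S => by rw [ha]; exact sq_nonneg _
  have hdeg := deg_bound ha0 (z := (s ^ 2)⁻¹) (by positivity) K hτ ∅
  have hpz : p ≤ (s ^ 2)⁻¹ := by
    rw [← one_div, le_div_iff₀ (by positivity)]; nlinarith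
  calc _ ≤ Ex p (fun x => ∑ T, if heavy a (s ^ 2)⁻¹ K τ T ∧ T ⊆ ones x then (T.card : ℝ) else 0) :=
        Ex_mono hp hp1 fun x => card_MM_le _ _
    _ = ∑ T, if heavy a (s ^ 2)⁻¹ K τ T then (T.card : ℝ) * p ^ T.card else 0 := by
        rw [Ex_sum]
        refine Finset.sum_congr rfl fun T _ => ?_
        by_cases h : heavy a (s ^ 2)⁻¹ K τ T
        · rw [if_pos h, ← Ex_ones, ← Ex_mul]
          congr 1
          funext x
          simp [h]
        · simp [h, Ex]
    _ ≤ ∑ T, K * (if ∅ ⊆ T ∧ heavy a (s ^ 2)⁻¹ K τ T then ((s ^ 2)⁻¹) ^ (T \ ∅).card else 0) := by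
        refine Finset.sum_le_sum fun T _ => ?_
        by_cases h : heavy a (s ^ 2)⁻¹ K τ T
        · rw [if_pos h, if_pos ⟨Finset.empty_subset _, h⟩, Finset.sdiff_empty]
          have : (T.card : ℝ) ≤ K := by exact_mod_cast h.1
          gcongr
        · simp [h]
    _ ≤ K * (2 ^ K * WW a (s ^ 2)⁻¹ K ∅ / τ) := by
        rw [← Finset.mul_sum]
        gcongr
    _ ≤ _ := by gcongr

lemma wt_lattice {n : ℕ} (p : ℝ) (a b : Fin n → Bool) :
    wt p a * wt p b = wt p (a ⊓ b) * wt p (a ⊔ b) := by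
  simp only [wt_eq_prod, ← Finset.prod_mul_distrib]
  refine Finset.prod_congr rfl fun i _ => ?_
  simp only [Pi.inf_apply, Pi.sup_apply]
  rcases Bool.eq_false_or_eq_true (a i) with ha | ha <;>
    rcases Bool.eq_false_or_eq_true (b i) with hb | hb <;> simp [ha, hb, mul_comm]

lemma mup_eq {n : ℕ} (p : ℝ) (E : Set (Fin n → Bool)) :
    mup p E = Ex p (fun x => if x ∈ E then 1 else 0) := by
  unfold mup Ex
  exact Finset.sum_congr rfl fun x _ => by simp

lemma ones_mono {n : ℕ} {x y : Fin n → Bool} (h : x ≤ y) : ones x ⊆ ones y := by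
  intro i hi
  rw [mem_ones] at *
  have := h i
  rw [hi] at this
  exact top_le_iff.mp this

lemma MM_idem {n : ℕ} (H : Finset (Fin n) → Prop) (S : Finset (Fin n)) :
    MM H (MM H S) = MM H S := by
  refine Finset.Subset.antisymm (MM_subset _ _) fun i hi => ?_
  obtain ⟨T, hT, hH, hiT⟩ := mem_MM.mp hi
  exact mem_MM.mpr ⟨T, fun j hj => mem_MM.mpr ⟨T, hT, hH, hj⟩, hH, hiT⟩

lemma not_boost {n : ℕ} {p δ : ℝ} (hp : 0 < p) (hp1 : p < 1) (f : (Fin n → Bool) → Bool)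
    (hf : IncreasingBool f) (H : Finset (Fin n) → Prop) (x : Fin n → Bool)
    (hb : ¬ BoostingSet p δ f (MM H (ones x))) :
    condE p (fun x => MM H (ones x)) (FF f) x < 1 - δ := by
  unfold condE
  rw [div_lt_iff₀ (atom_pos hp hp1 (fun x => MM H (ones x)) x)]
  obtain ⟨J0, hJ0⟩ : ∃ J0, J0 = MM H (ones x) := ⟨_, rfl⟩
  have hJM : MM H J0 = J0 := by rw [hJ0, MM_idem]
  have hJx : J0 ⊆ ones x := by rw [hJ0]; exact MM_subset _ _
  simp only [← hJ0] at hb ⊢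
  have hatom : ∀ y, MM H (ones y) = J0 ↔ J0 ⊆ ones y ∧ MM H (ones y) ⊆ J0 := by
    intro y
    constructor
    · intro h
      exact ⟨h ▸ MM_subset _ _, h.subset⟩
    · rintro ⟨h1, h2⟩
      refine Finset.Subset.antisymm h2 ?_
      conv_lhs => rw [← hJM]
      exact MM_mono H h1
  unfold BoostingSet at hb
  push Not at hb
  obtain ⟨μ, hμ⟩ : ∃ μ : (Fin n → Bool) → ℝ, μ = fun y => if J0 ⊆ ones y then wt p y else 0 := ⟨_, rfl⟩
  obtain ⟨G, hG⟩ : ∃ G : (Fin n → Bool) → ℝ, G = fun y => if MM H (ones y) ⊆ J0 then 0 else 1 := ⟨_, rfl⟩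
  have hμ0 : ∀ y, 0 ≤ μ y := by
    intro y; rw [hμ]; dsimp only; have := wt_pos hp hp1 y; split_ifs <;> linarith
  have hfkg := fkg (μ := μ) (f := FF f) (g := G) hμ0 (FF_nonneg f)
    (by intro y; rw [hG]; dsimp only [Pi.zero_apply]; split_ifs <;> norm_num)
    (by
      intro y y' h
      unfold FF
      have := hf y y' h
      split_ifs with h1 h2
      · exact le_rfl
      · rw [h1] at this; exact absurd (top_le_iff.mp this) h2
      · norm_num
      · exact le_rfl)
    (by
      intro y y' h
      rw [hG]; dsimp only
      have := MM_mono H (ones_mono h)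
      split_ifs with h1 h2 h2
      · exact le_rfl
      · norm_num
      · exact absurd (this.trans h2) h1
      · exact le_rfl)
    (by
      intro y y'
      rw [hμ]; dsimp only
      by_cases h1 : J0 ⊆ ones y
      · by_cases h2 : J0 ⊆ ones y'
        · have h3 : J0 ⊆ ones (y ⊓ y') := by
            intro i hi
            rw [mem_ones, Pi.inf_apply, mem_ones.mp (h1 hi), mem_ones.mp (h2 hi)]; rfl
          have h4 : J0 ⊆ ones (y ⊔ y') := h1.trans (ones_mono le_sup_left)
          rw [if_pos h1, if_pos h2, if_pos h3, if_pos h4, wt_lattice]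
        · rw [if_neg h2, mul_zero]
          have := wt_pos hp hp1 (y ⊓ y')
          have := wt_pos hp hp1 (y ⊔ y')
          refine mul_nonneg ?_ ?_ <;> split_ifs <;> linarith
      · rw [if_neg h1, zero_mul]
        have := wt_pos hp hp1 (y ⊓ y')
        have := wt_pos hp hp1 (y ⊔ y')
        refine mul_nonneg ?_ ?_ <;> split_ifs <;> linarith)
  have eA : mup p {x | f x = true ∧ ∀ i ∈ J0, x i = true}
      = ∑ y, μ y * FF f y := by
    refine Finset.sum_congr rfl fun y _ => ?_
    have : (J0 ⊆ ones y) ↔ ∀ i ∈ J0, y i = true := by simp [Finset.subset_iff, mem_ones]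
    simp only [hμ, this, FF, Set.mem_ofPred_eq]
    by_cases h1 : f y = true <;> by_cases h2 : ∀ i ∈ J0, y i = true <;> simp [h1, h2]
  have eB : mup p {x : Fin n → Bool | ∀ i ∈ J0, x i = true}
      = ∑ y, μ y := by
    refine Finset.sum_congr rfl fun y _ => ?_
    have : (J0 ⊆ ones y) ↔ ∀ i ∈ J0, y i = true := by simp [Finset.subset_iff, mem_ones]
    simp only [hμ, this, Set.mem_ofPred_eq]
    by_cases h2 : ∀ i ∈ J0, y i = true <;> simp [h2]
  have eC : Ex p (fun y => if MM H (ones y) = J0 then FF f y else 0)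
      = ∑ y, μ y * FF f y - ∑ y, μ y * (FF f y * G y) := by
    rw [← Finset.sum_sub_distrib]
    refine Finset.sum_congr rfl fun y _ => ?_
    simp only [hμ, hG, hatom]
    by_cases h1 : J0 ⊆ ones y <;> by_cases h2 : MM H (ones y) ⊆ J0 <;> simp [h1, h2]
  have eD : Ex p (fun y => if MM H (ones y) = J0 then 1 else 0)
      = ∑ y, μ y - ∑ y, μ y * G y := by
    rw [← Finset.sum_sub_distrib]
    refine Finset.sum_congr rfl fun y _ => ?_
    simp only [hμ, hG, hatom]
    by_cases h1 : J0 ⊆ ones y <;> by_cases h2 : MM H (ones y) ⊆ J0 <;> simp [h1, h2]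
  have eP := atom_pos hp hp1 (fun x => MM H (ones x)) x
  simp only [← hJ0] at eP
  rw [eD] at eP
  rw [eA, eB] at hb
  rw [eC, eD]
  have hGn : 0 ≤ ∑ y, μ y * G y := by
    refine Finset.sum_nonneg fun y _ => mul_nonneg (hμ0 y) ?_
    rw [hG]; dsimp only; split_ifs <;> norm_num
  generalize ∑ y, μ y = m at *
  generalize ∑ y, μ y * FF f y = mf at *
  generalize ∑ y, μ y * G y = mg at *
  generalize ∑ y, μ y * (FF f y * G y) = mfg at *
  have hm : 0 < m := by linarith
  have h1 : m * (mf - mfg) ≤ mf * (m - mg) := by linarith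
  have h2 : mf * (m - mg) < (1 - δ) * m * (m - mg) := mul_lt_mul_of_pos_right hb eP
  have h3 : m * (mf - mfg) < m * ((1 - δ) * (m - mg)) := by linarith
  exact lt_of_mul_lt_mul_left h3 hm.le

lemma condE_le_one {n : ℕ} {p : ℝ} (hp : 0 < p) (hp1 : p < 1)
    (J : (Fin n → Bool) → Finset (Fin n)) (φ : (Fin n → Bool) → ℝ) (hφ : ∀ x, φ x ≤ 1)
    (x : Fin n → Bool) : condE p J φ x ≤ 1 := by
  unfold condE
  rw [div_le_one (atom_pos hp hp1 J x)]
  refine Ex_mono hp hp1 fun y => ?_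
  have := hφ y
  split_ifs <;> linarith

lemma conclude {n : ℕ} {p δ k : ℝ} (hp : 0 < p) (hp1 : p < 1) (hδ : 0 < δ) (hk : 0 < k)
    (f : (Fin n → Bool) → Bool) (hf : IncreasingBool f) (H : Finset (Fin n) → Prop) :
    mup p ({x | f x = true} \ Bev p δ k f) ≤
      k⁻¹ * Ex p (fun x => ((MM H (ones x)).card : ℝ)) +
      δ⁻¹ * Ex p (fun x => FF f x * (FF f x - condE p (fun x => MM H (ones x)) (FF f) x)) := by
  rw [mup_eq, ← Ex_mul, ← Ex_mul, ← Ex_add]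
  refine Ex_mono hp hp1 fun x => ?_
  have hc1 := condE_le_one hp hp1 (fun x => MM H (ones x)) (FF f)
    (fun x => (le_abs_self _).trans (FF_abs f x)) x
  have hnn : 0 ≤ FF f x * (FF f x - condE p (fun x => MM H (ones x)) (FF f) x) := by
    rcases FF_cases f x with h | h <;> rw [h] <;> linarith
  split_ifs with hx
  · obtain ⟨hfx, hB⟩ := hx
    simp only [Set.mem_ofPred_eq] at hfx
    by_cases hJ : ((MM H (ones x)).card : ℝ) ≤ k
    · have hnb : ¬ BoostingSet p δ f (MM H (ones x)) := fun h =>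
        hB ⟨_, hJ, fun i hi => mem_ones.mp (MM_subset _ _ hi), h⟩
      have := not_boost hp hp1 f hf H x hnb
      have hF : FF f x = 1 := by simp [FF, hfx]
      rw [hF] at hnn ⊢
      have h1 : 1 ≤ δ⁻¹ * (1 * (1 - condE p (fun x => MM H (ones x)) (FF f) x)) := by
        rw [inv_mul_eq_div, le_div_iff₀ hδ]; linarith
      have h2 : 0 ≤ k⁻¹ * ((MM H (ones x)).card : ℝ) := by positivity
      linarith
    · push Not at hJ
      have h1 : 1 ≤ k⁻¹ * ((MM H (ones x)).card : ℝ) := by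
        rw [inv_mul_eq_div, le_div_iff₀ hk]; linarith
      have h2 : 0 ≤ δ⁻¹ * (FF f x * (FF f x - condE p (fun x => MM H (ones x)) (FF f) x)) := by
        positivity
      linarith
  · positivity

lemma const_true {n : ℕ} (f : (Fin n → Bool) → Bool) (p ε δ k : ℝ) (h : ∀ x, f x = true)
    (hε0 : 0 < ε) (hδ0 : 0 < δ) (hk : 0 ≤ k) :
    mup p ({x | f x = true} \ Bev p δ k f) ≤ ε := by
  have hb : BoostingSet p δ f ∅ := by
    unfold BoostingSet
    have h1 : mup p {x : Fin n → Bool | ∀ i ∈ (∅ : Finset (Fin n)), x i = true} = 1 := by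
      rw [mup_eq]; refine Eq.trans ?_ (Ex_one (n := n) p); congr 1; funext x; simp
    have h2 : mup p {x : Fin n → Bool | f x = true ∧ ∀ i ∈ (∅ : Finset (Fin n)), x i = true} = 1 := by
      rw [mup_eq]; refine Eq.trans ?_ (Ex_one (n := n) p); congr 1; funext x; simp [h]
    rw [h1, h2]; linarith
  have hB : ∀ x, x ∈ Bev p δ k f := fun x => ⟨∅, by simpa using hk, by simp, hb⟩
  unfold mup
  rw [Finset.sum_eq_zero]
  · exact hε0.le
  · intro x _
    rw [if_neg]
    exact fun hx => hx.2 (hB x)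

lemma infl_zero_const {n : ℕ} {p : ℝ} (hp : 0 < p) (hp1 : p < 1) (f : (Fin n → Bool) → Bool)
    (h : totalInfluence p f = 0) (x y : Fin n → Bool) : f x = f y := by
  rw [totalInfluence_eq] at h
  have hq : 0 < 1 - p := by linarith
  have h1 : ∀ i x b, f (Function.update x i b) = f x := by
    intro i x b
    by_contra hne
    have hi := (Finset.sum_eq_zero_iff_of_nonneg (fun i _ => Infl_nonneg hp hp1 f i)).mp h i
      (Finset.mem_univ _)
    have hnn : ∀ (x : Fin n → Bool) (b : Bool), 0 ≤ wt p x * (if b then p else 1 - p) *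
      (if f x = f (Function.update x i b) then 0 else 1) := by
      intro x b
      have := wt_pos hp hp1 x
      refine mul_nonneg (mul_nonneg (by positivity) ?_) ?_ <;> split_ifs <;> linarith
    unfold Infl at hi
    have hx := (Finset.sum_eq_zero_iff_of_nonneg
      (fun x _ => Finset.sum_nonneg fun b _ => hnn x b)).mp hi x (Finset.mem_univ _)
    have hb := (Finset.sum_eq_zero_iff_of_nonneg (fun b _ => hnn x b)).mp hx b (Finset.mem_univ _)
    have hne2 : ¬ f x = f (Function.update x i b) := fun h => hne h.symm
    rw [if_neg hne2, mul_one] at hb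
    have := wt_pos hp hp1 x
    have : 0 < wt p x * (if b then p else 1 - p) := by
      refine mul_pos this ?_
      split_ifs <;> linarith
    linarith
  have h2 : ∀ T : Finset (Fin n), f (fun j => if j ∈ T then y j else x j) = f x := by
    intro T
    induction T using Finset.induction_on with
    | empty => simp
    | insert i T hi ih =>
      rw [← ih, ← h1 i (fun j => if j ∈ T then y j else x j) (y i)]
      congr 1
      funext j
      by_cases hj : j = i
      · subst hj; simp
      · simp [hj]
  have := h2 Finset.univ
  simp only [Finset.mem_univ, if_true] at this
  exact this.symm

lemma num2 (K : ℕ) (hK : 1 ≤ K) :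
    (K : ℝ) * (2 ^ K * 4 ^ K / (2 ^ (30 * K ^ 2))⁻¹) ≤ 2 ^ (34 * K ^ 2) := by
  have h1 : (K : ℝ) ≤ 2 ^ K := by exact_mod_cast (Nat.lt_two_pow_self (n := K)).le
  calc (K : ℝ) * (2 ^ K * 4 ^ K / (2 ^ (30 * K ^ 2))⁻¹)
      ≤ 2 ^ K * (2 ^ K * 4 ^ K / (2 ^ (30 * K ^ 2))⁻¹) := by gcongr
    _ = 2 ^ (K + (K + 2 * K + 30 * K ^ 2)) := by
      rw [div_inv_eq_mul, show (4 : ℝ) = 2 ^ 2 by norm_num, ← pow_mul, ← pow_add, ← pow_add, ← pow_add]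
    _ ≤ _ := pow_le_pow_right₀ (by norm_num) (by nlinarith)

lemma num3 (K : ℕ) {x : ℝ} (hx : (K : ℝ) ≤ 17 * x) :
    (2 : ℝ) ^ (35 * K ^ 2) ≤ Real.exp (10 ^ 12 * x ^ 2) := by
  have h2 : (2 : ℝ) ≤ Real.exp 1 := by
    have := Real.add_one_le_exp (1 : ℝ); linarith
  calc (2 : ℝ) ^ (35 * K ^ 2) ≤ (Real.exp 1) ^ (35 * K ^ 2) := by gcongr
    _ = Real.exp (35 * K ^ 2) := by
      rw [← Real.exp_nat_mul]; push_cast; rw [mul_one]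
    _ ≤ _ := by
      apply Real.exp_le_exp.mpr
      have : (K : ℝ) ^ 2 ≤ (17 * x) ^ 2 := by gcongr
      nlinarith [sq_nonneg x]

lemma main_case {n : ℕ} (f : (Fin n → Bool) → Bool) (p ε δ : ℝ)
    (hf : IncreasingBool f) (hp0 : 0 < p) (hp : p ≤ 1 / 2)
    (hε0 : 0 < ε) (hε1 : ε < 1) (hδ0 : 0 < δ) (hδ1 : δ < 1) (c x0 : ℝ)
    (hc : 1 ≤ c) (hI : totalInfluence p f ≤ c) (hx : x0 = c / (δ * ε)) :
    mup p ({x | f x = true} \ Bev p δ (Real.exp (10 ^ 12 * x0 ^ 2)) f) ≤ ε := by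
  have hp1 : p < 1 := by linarith
  obtain ⟨s, hs⟩ : ∃ s, s = Real.sqrt ((1 - p) / p) := ⟨_, rfl⟩
  have hge : 1 ≤ (1 - p) / p := by rw [le_div_iff₀ hp0]; linarith
  have hs1 : 1 ≤ s := by rw [hs]; exact Real.one_le_sqrt.mpr hge
  have hps : p * (1 + s ^ 2) = 1 := by
    rw [hs, Real.sq_sqrt (by linarith)]; field_simp; ring
  have hde : 0 < δ * ε := by positivity
  have hde1 : δ * ε < 1 := by nlinarith
  have hx1 : 1 ≤ x0 := by rw [hx, le_div_iff₀ hde]; linarith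
  obtain ⟨K, hKd⟩ : ∃ K, K = ⌈16 * x0⌉₊ := ⟨_, rfl⟩
  have hK16 : 16 * x0 ≤ K := by rw [hKd]; exact Nat.le_ceil _
  have hK17 : (K : ℝ) ≤ 17 * x0 := by
    have := Nat.ceil_lt_add_one (show 0 ≤ 16 * x0 by linarith)
    rw [← hKd] at this; linarith
  have hKr : (16 : ℝ) ≤ K := by linarith
  have hK1 : 1 ≤ K := by
    have : (1 : ℝ) ≤ K := by linarith
    exact_mod_cast this
  obtain ⟨H, hH⟩ : ∃ H, H = heavy (fun S => hat p s (FF f) S ^ 2) (s ^ 2)⁻¹ K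
      ((2 ^ (30 * K ^ 2))⁻¹) := ⟨_, rfl⟩
  have hcon := conclude hp0 hp1 hδ0 (Real.exp_pos (10 ^ 12 * x0 ^ 2)) f hf H
  have hcard := Ex_card_J hp0 hp1 hs1 hps f K ((2 ^ (30 * K ^ 2))⁻¹) (by positivity)
  rw [← hH] at hcard
  have hnu := main_nu hp0 hp1 hs1 hps f K hK1 (fun x => MM H (ones x)) (by rw [hH])
  have hcx : c = x0 * (δ * ε) := by rw [hx]; field_simp
  have hKi : 1 / (K : ℝ) ≤ δ * ε / 16 := by
    rw [div_le_iff₀ (by linarith)]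
    nlinarith
  have b1 : (3 * totalInfluence p f + 2) / K ≤ 5 / 16 * (δ * ε) := by
    rw [div_le_iff₀ (by linarith)]
    nlinarith
  have b2 : δ⁻¹ * Ex p (fun x => FF f x * (FF f x - condE p (fun x => MM H (ones x)) (FF f) x))
      ≤ ε / 2 := by
    rw [inv_mul_le_iff₀ hδ0]; nlinarith
  have b3 : (Real.exp (10 ^ 12 * x0 ^ 2))⁻¹ * Ex p (fun x => ((MM H (ones x)).card : ℝ)) ≤ ε / 2 := by
    rw [inv_mul_le_iff₀ (Real.exp_pos _)]
    refine (hcard.trans (num2 K hK1)).trans ?_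
    have e1 : ((2 : ℝ) ^ K)⁻¹ ≤ ε / 2 := by
      have := two_pow_inv_le K hK1
      nlinarith
    have e2 : (2 : ℝ) ^ (34 * K ^ 2) ≤ 2 ^ (35 * K ^ 2) * (2 ^ K)⁻¹ := by
      rw [← div_eq_mul_inv, le_div_iff₀ (by positivity), ← pow_add]
      exact pow_le_pow_right₀ (by norm_num) (by nlinarith)
    have e3 := num3 K hK17
    exact e2.trans (mul_le_mul e3 e1 (by positivity) (Real.exp_pos _).le)
  exact hcon.trans ((add_le_add b3 b2).trans (by linarith))


/-- For an increasing boolean function `f` and `p ≤ 1/2`, for any `ε, δ ∈ (0,1)`,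
with `k = exp(10^{12} ⌈I_f(p)⌉² (δε)^{-2})` one has
`μ_p({f = 1} \ B_{δ,k}) ≤ ε`. -/
theorem boosting_set_exists {n : ℕ} (f : (Fin n → Bool) → Bool) (p ε δ : ℝ)
    (hf : IncreasingBool f) (hp0 : 0 ≤ p) (hp : p ≤ 1 / 2)
    (hε0 : 0 < ε) (hε1 : ε < 1) (hδ0 : 0 < δ) (hδ1 : δ < 1) :
    mup p ({x | f x = true} \
        Bev p δ (Real.exp (10 ^ 12 * (Int.ceil (totalInfluence p f) : ℝ) ^ 2 *
          (δ * ε) ^ (-2 : ℝ))) f) ≤ ε := by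
  rcases hp0.eq_or_lt with h0 | h0
  · subst h0
    by_cases hz : f (fun _ => false) = true
    · refine const_true f _ ε δ _ ?_ hε0 hδ0 (Real.exp_pos _).le
      intro x
      have := hf (fun _ => false) x (fun i => Bool.false_le _)
      rw [hz] at this
      exact top_le_iff.mp this
    · unfold mup
      rw [Finset.sum_eq_zero]
      · exact hε0.le
      · intro x _
        split_ifs with hx
        · have hfx : f x = true := hx.1
          have hex : ∃ i, x i = true := by
            by_contra hcon
            push Not at hcon
            have : x = fun _ => false := by
              funext i; simpa using hcon i
            rw [this] at hfx
            exact hz hfx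
          obtain ⟨i, hi⟩ := hex
          rw [wt_eq_prod]
          exact Finset.prod_eq_zero (Finset.mem_univ i) (by simp [hi])
        · rfl
  · have hp1 : p < 1 := by linarith
    have hI : 0 ≤ totalInfluence p f := by
      rw [totalInfluence_eq]
      exact Finset.sum_nonneg fun i _ => Infl_nonneg h0 hp1 f i
    rcases hI.eq_or_lt with hI0 | hI0
    · have hconst := infl_zero_const h0 hp1 f hI0.symm
      by_cases hz : f (fun _ => false) = true
      · refine const_true f _ ε δ _ ?_ hε0 hδ0 (Real.exp_pos _).le
        intro x
        rw [hconst x (fun _ => false), hz]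
      · unfold mup
        rw [Finset.sum_eq_zero]
        · exact hε0.le
        · intro x _
          rw [if_neg]
          intro hx
          have hfx : f x = true := hx.1
          rw [hconst x (fun _ => false)] at hfx
          exact hz hfx
    · have hc : (1 : ℝ) ≤ (Int.ceil (totalInfluence p f) : ℝ) := by
        exact_mod_cast Int.one_le_ceil_iff.mpr hI0
      have h := main_case f p ε δ hf h0 hp hε0 hε1 hδ0 hδ1 _ _ hc (Int.le_ceil _) rfl
      have e : (10 ^ 12 * (Int.ceil (totalInfluence p f) : ℝ) ^ 2 * (δ * ε) ^ (-2 : ℝ))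
          = 10 ^ 12 * ((Int.ceil (totalInfluence p f) : ℝ) / (δ * ε)) ^ 2 := by
        rw [Real.rpow_neg (by positivity), Real.rpow_ofNat, div_pow, div_eq_mul_inv]
        ring
      rw [e]
      exact h
end
end

section
/- For N sufficiently large and any ε_N ∈ [(log log N)^{-1/10}, 1), the quantity p* := inf{p ≥ p_N(ε_N) : I(p) ≤ 8 (log log N)^{1/10}} satisfies p_N(ε_N) ≤ p* ≤ p_N(ε_N) · (1 + (log log N)^{-1/10}/2). -/
open scoped Classical

noncomputable section

/-- A point of the discrete cube `Σ_N = {-1,1}^N`, encoded by booleans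
(`true ↦ +1`, `false ↦ -1`). -/
abbrev Cube (N : ℕ) := Fin N → Bool

/-- The `±1` value encoded by a boolean. -/
def pmVal (b : Bool) : ℝ := if b then 1 else -1

/-- The inner product `x · y = ∑ i x^i y^i` on `Σ_N`. -/
def cubeDot {N : ℕ} (x y : Cube N) : ℝ := ∑ i, pmVal (x i) * pmVal (y i)

/-- The half cube `H(x) := {y ∈ Σ_N : x · y ≥ κ √N}`. -/
def halfCube {N : ℕ} (κ : ℝ) (x : Cube N) : Set (Cube N) :=
  {y | cubeDot x y ≥ κ * Real.sqrt N}

/-- Bernoulli(p) product weight of a configuration `ω : Σ_N → {0,1}`. -/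
def bWeight {N : ℕ} (p : ℝ) (ω : Cube N → Bool) : ℝ :=
  p ^ (Finset.univ.filter fun x => ω x = true).card *
    (1 - p) ^ (Finset.univ.filter fun x => ω x = false).card

/-- The product Bernoulli measure `ℙ_p` of an event `E ⊆ {0,1}^{Σ_N}`. -/
def bernoulliP {N : ℕ} (p : ℝ) (E : Set (Cube N → Bool)) : ℝ :=
  ∑ ω : Cube N → Bool, if ω ∈ E then bWeight p ω else 0

/-- The event `E = {⋂_{x : ω_x = 1} H(x) = ∅}`. -/
def emptyInter {N : ℕ} (κ : ℝ) : Set (Cube N → Bool) :=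
  {ω | (⋂ x ∈ {x : Cube N | ω x = true}, halfCube κ x) = (∅ : Set (Cube N))}

/-- The total influence `I(p)` of the indicator of the event `E` as a boolean
function of `(ω_x)_{x ∈ Σ_N}`: `I(p) = ∑_x ℙ_p(1_E(ω) ≠ 1_E(ω^{(x)}))`, where
`ω^{(x)}` resamples coordinate `x` independently. -/
def influence {N : ℕ} (κ p : ℝ) : ℝ :=
  ∑ x : Cube N, ∑ ω : Cube N → Bool, ∑ b : Bool,
    bWeight p ω * (if b then p else 1 - p) *
      (if (ω ∈ emptyInter κ ↔ Function.update ω x b ∈ emptyInter κ) then 0 else 1)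

/-- `p* := inf {p ≥ p_N(ε_N) : I(p) ≤ 8 (log log N)^{1/10}}`. -/
def pStar {N : ℕ} (κ pN : ℝ) : ℝ :=
  sInf {p : ℝ | pN ≤ p ∧ influence (N := N) κ p ≤ 8 * Real.log (Real.log N) ^ ((1 : ℝ) / 10)}

def wgt (p : ℝ) (b : Bool) : ℝ := if b then p else 1 - p

def sgnB (b : Bool) : ℝ := if b then 1 else -1

theorem bWeight_eq {N : ℕ} (p : ℝ) (ω : Cube N → Bool) :
    bWeight p ω = ∏ x, wgt p (ω x) := by
  unfold bWeight wgt
  rw [Finset.prod_ite]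
  simp

theorem bWeight_nonneg {N : ℕ} {p : ℝ} (h0 : 0 ≤ p) (h1 : p ≤ 1) (ω : Cube N → Bool) :
    0 ≤ bWeight p ω := by
  unfold bWeight
  have : 0 ≤ 1 - p := by linarith
  positivity

theorem sum_bWeight {N : ℕ} (p : ℝ) : ∑ ω : Cube N → Bool, bWeight p ω = 1 := by
  simp only [bWeight_eq]
  have := Finset.prod_univ_sum (fun _ : Cube N => (Finset.univ : Finset Bool))
    (fun _ b => wgt p b)
  rw [Fintype.piFinset_univ] at this
  rw [← this]
  simp [wgt]

theorem bernoulliP_nonneg {N : ℕ} {p : ℝ} (h0 : 0 ≤ p) (h1 : p ≤ 1)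
    (E : Set (Cube N → Bool)) : 0 ≤ bernoulliP p E := by
  unfold bernoulliP
  refine Finset.sum_nonneg fun ω _ => ?_
  split_ifs
  · exact bWeight_nonneg h0 h1 ω
  · exact le_rfl

theorem bernoulliP_le_one {N : ℕ} {p : ℝ} (h0 : 0 ≤ p) (h1 : p ≤ 1)
    (E : Set (Cube N → Bool)) : bernoulliP p E ≤ 1 := by
  rw [← sum_bWeight (N := N) p]
  unfold bernoulliP
  refine Finset.sum_le_sum fun ω _ => ?_
  split_ifs
  · exact le_rfl
  · exact bWeight_nonneg h0 h1 ω

/-- weight without the coordinate `x` -/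
def wOff {N : ℕ} (p : ℝ) (x : Cube N) (ω : Cube N → Bool) : ℝ :=
  ∏ y ∈ Finset.univ.erase x, wgt p (ω y)

def flipAt {N : ℕ} (x : Cube N) (ω : Cube N → Bool) : Cube N → Bool :=
  Function.update ω x (!(ω x))

def indE {N : ℕ} (E : Set (Cube N → Bool)) (ω : Cube N → Bool) : ℝ := if ω ∈ E then 1 else 0

theorem flipAt_flipAt {N : ℕ} (x : Cube N) (ω : Cube N → Bool) :
    flipAt x (flipAt x ω) = ω := by
  simp [flipAt]

theorem wOff_flipAt {N : ℕ} (p : ℝ) (x : Cube N) (ω : Cube N → Bool) :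
    wOff p x (flipAt x ω) = wOff p x ω := by
  unfold wOff
  refine Finset.prod_congr rfl fun y hy => ?_
  have : y ≠ x := Finset.ne_of_mem_erase hy
  simp [flipAt, Function.update_of_ne this]

theorem sum_flip {N : ℕ} (x : Cube N) (g : (Cube N → Bool) → ℝ) :
    ∑ ω, g (flipAt x ω) = ∑ ω, g ω :=
  Equiv.sum_comp (Function.Involutive.toPerm (flipAt x) (flipAt_flipAt x)) g

def dP {N : ℕ} (p : ℝ) (E : Set (Cube N → Bool)) : ℝ :=
  ∑ x : Cube N, ∑ ω : Cube N → Bool, indE E ω * (wOff p x ω * sgnB (ω x))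

theorem hasDerivAt_wgt (p : ℝ) (b : Bool) : HasDerivAt (fun p => wgt p b) (sgnB b) p := by
  cases b
  · simpa [wgt, sgnB] using (hasDerivAt_id p).const_sub 1
  · simpa [wgt, sgnB] using (hasDerivAt_id' p)

theorem hasDerivAt_P {N : ℕ} (p : ℝ) (E : Set (Cube N → Bool)) :
    HasDerivAt (fun p => bernoulliP p E) (dP p E) p := by
  have h1 : (fun p => bernoulliP p E) =
      fun p => ∑ ω : Cube N → Bool, indE E ω * ∏ x, wgt p (ω x) := by
    funext p
    unfold bernoulliP
    refine Finset.sum_congr rfl fun ω _ => ?_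
    rw [bWeight_eq]
    simp [indE]
  rw [h1]
  unfold dP
  rw [Finset.sum_comm]
  refine HasDerivAt.fun_sum fun ω _ => ?_
  rw [← Finset.mul_sum]
  refine HasDerivAt.const_mul _ ?_
  have := HasDerivAt.fun_finsetProd (u := Finset.univ) (f := fun (x : Cube N) p => wgt p (ω x))
    (f' := fun x => sgnB (ω x)) (x := p) (fun x _ => hasDerivAt_wgt p (ω x))
  simpa [wOff, smul_eq_mul] using this

theorem emptyInter_update {N : ℕ} (κ : ℝ) (ω : Cube N → Bool) (x : Cube N)
    (h : ω ∈ emptyInter κ) : Function.update ω x true ∈ emptyInter κ := by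
  unfold emptyInter at *
  simp only [Set.mem_ofPred_eq] at *
  rw [← Set.subset_empty_iff] at *
  refine subset_trans ?_ h
  intro y hy
  simp only [Set.mem_iInter] at *
  intro z hz
  refine hy z ?_
  by_cases hzx : z = x
  · subst hzx; simp
  · simpa [Function.update_of_ne hzx] using hz

theorem key_pt {N : ℕ} (κ : ℝ) (x : Cube N) (ω : Cube N → Bool) :
    sgnB (ω x) * (indE (emptyInter κ) ω - indE (emptyInter κ) (flipAt x ω)) =
      if (ω ∈ emptyInter κ ↔ flipAt x ω ∈ emptyInter κ) then 0 else 1 := by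
  cases hb : ω x
  · have h : ω ∈ emptyInter κ → flipAt x ω ∈ emptyInter κ := by
      intro h
      have := emptyInter_update κ ω x h
      simpa [flipAt, hb] using this
    by_cases h1 : ω ∈ emptyInter κ
    · simp [h1, h h1, indE]
    · by_cases h2 : flipAt x ω ∈ emptyInter κ <;> simp [h1, h2, indE, sgnB]
  · have h : flipAt x ω ∈ emptyInter κ → ω ∈ emptyInter κ := by
      intro h
      have := emptyInter_update κ _ x h
      have e : Function.update (flipAt x ω) x true = ω := by
        simp [flipAt, ← hb]
      rwa [e] at this
    by_cases h2 : flipAt x ω ∈ emptyInter κ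
    · simp [h2, h h2, indE]
    · by_cases h1 : ω ∈ emptyInter κ <;> simp [h1, h2, indE, sgnB]

theorem innerInfl_sum {N : ℕ} (κ p : ℝ) (x : Cube N) (ω : Cube N → Bool) :
    ∑ b : Bool, bWeight p ω * (if b then p else 1 - p) *
      (if (ω ∈ emptyInter κ ↔ Function.update ω x b ∈ emptyInter κ) then 0 else 1)
    = p * (1 - p) * (wOff p x ω *
      if (ω ∈ emptyInter κ ↔ flipAt x ω ∈ emptyInter κ) then 0 else 1) := by
  have hw : bWeight p ω = wgt p (ω x) * wOff p x ω := by
    rw [bWeight_eq, wOff]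
    exact (Finset.mul_prod_erase _ (fun y => wgt p (ω y)) (Finset.mem_univ x)).symm
  rw [hw]
  have hs : Function.update ω x (ω x) = ω := Function.update_eq_self x ω
  cases hb : ω x
  · rw [hb] at hs
    simp only [Fintype.sum_bool, hs, flipAt, hb, wgt]
    simp
    split_ifs <;> ring
  · rw [hb] at hs
    simp only [Fintype.sum_bool, hs, flipAt, hb, wgt]
    simp
    split_ifs <;> ring

theorem russo {N : ℕ} (κ p : ℝ) :
    influence (N := N) κ p = 2 * (p * (1 - p)) * dP p (emptyInter (N := N) κ) := by
  unfold influence dP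
  rw [Finset.mul_sum]
  refine Finset.sum_congr rfl fun x _ => ?_
  rw [Finset.sum_congr rfl fun ω _ => innerInfl_sum κ p x ω, ← Finset.mul_sum]
  have h := sum_flip x (fun ω => indE (emptyInter κ) ω * (wOff p x ω * sgnB (ω x)))
  have h2 : ∀ ω : Cube N → Bool, sgnB (flipAt x ω x) = - sgnB (ω x) := by
    intro ω
    cases hb : ω x <;> simp [flipAt, hb, sgnB]
  simp only [wOff_flipAt, h2] at h
  have h3 : ∑ ω : Cube N → Bool, (wOff p x ω *
      if (ω ∈ emptyInter κ ↔ flipAt x ω ∈ emptyInter κ) then (0 : ℝ) else 1)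
      = ∑ ω, indE (emptyInter κ) ω * (wOff p x ω * sgnB (ω x)) +
        ∑ ω, indE (emptyInter κ) (flipAt x ω) * (wOff p x ω * -sgnB (ω x)) := by
    rw [← Finset.sum_add_distrib]
    refine Finset.sum_congr rfl fun ω _ => ?_
    rw [← key_pt]
    ring
  rw [h3, h]
  ring

theorem pStar_aux {N : ℕ} (κ M pN : ℝ) (hM : 1 ≤ M) (h0 : 0 ≤ pN) (h1 : pN ≤ 1) :
    ∃ p, (pN ≤ p ∧ influence (N := N) κ p ≤ 8 * M) ∧ p ≤ pN * (1 + M⁻¹ / 2) := by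
  have hMp : 0 < M := by linarith
  have hi : 0 < M⁻¹ := inv_pos.2 hMp
  have hi1 : M⁻¹ ≤ 1 := inv_le_one_of_one_le₀ hM
  set q := pN * (1 + M⁻¹ / 2) with hq
  rcases le_or_gt 1 q with hq1 | hq1
  · exact ⟨1, ⟨h1, by rw [russo]; simp; linarith⟩, hq1⟩
  rcases h0.eq_or_lt with h | hpos
  · refine ⟨pN, ⟨le_rfl, ?_⟩, by rw [hq, ← h]; simp⟩
    rw [russo, ← h]; simp; linarith
  by_contra hcon
  push Not at hcon
  have hlt : pN < q := by rw [hq]; nlinarith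
  obtain ⟨c, hc, hd⟩ := exists_hasDerivAt_eq_slope
    (fun p => bernoulliP p (emptyInter (N := N) κ)) (fun p => dP p (emptyInter (N := N) κ)) hlt
    (fun p _ => (hasDerivAt_P p _).continuousAt.continuousWithinAt)
    (fun p _ => hasDerivAt_P p _)
  have hI : 8 * M < influence (N := N) κ c := by
    by_contra hh
    exact absurd hc.2 (not_lt.2 (hcon c ⟨hc.1.le, not_lt.1 hh⟩).le)
  rw [russo] at hI
  have hc0 : 0 < c := hpos.trans hc.1
  have hc1 : 0 < 1 - c := by linarith [hc.2]
  have hb1 := bernoulliP_le_one (p := q) (by linarith) hq1.le (emptyInter (N := N) κ)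
  have hb0 := bernoulliP_nonneg h0 h1 (emptyInter (N := N) κ)
  have hD1 : dP c (emptyInter (N := N) κ) * (q - pN) ≤ 1 := by
    rw [hd, div_mul_cancel₀ _ (by linarith)]
    linarith
  set D := dP c (emptyInter (N := N) κ)
  have hD : 0 < D := by
    by_contra hh
    have : 2 * (c * (1 - c)) * D ≤ 0 :=
      mul_nonpos_of_nonneg_of_nonpos (by positivity) (not_lt.1 hh)
    linarith
  have e1 : 8 * M < 2 * q * D := by
    have : c * (1 - c) ≤ q := by nlinarith [hc.2]
    nlinarith
  have e2 : q - pN = pN * M⁻¹ / 2 := by rw [hq]; ring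
  rw [e2] at hD1
  have e3 : D * pN ≤ 2 * M := by
    have : D * pN = (D * (pN * M⁻¹ / 2)) * (2 * M) := by field_simp
    rw [this]
    nlinarith
  have e4 : 2 * q * D = 2 * (D * pN) * (1 + M⁻¹ / 2) := by rw [hq]; ring
  rw [e4] at e1
  nlinarith [mul_pos hD hpos]

theorem pStar_bounds (κ : ℝ) :
    ∃ N₀ : ℕ, ∀ N : ℕ, N₀ ≤ N →
      ∀ εN pN : ℝ,
        Real.log (Real.log N) ^ (-(1 : ℝ) / 10) ≤ εN → εN < 1 →
        0 ≤ pN → pN ≤ 1 →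
        bernoulliP pN (emptyInter (N := N) κ) = εN →
        pN ≤ pStar (N := N) κ pN ∧
          pStar (N := N) κ pN ≤ pN * (1 + Real.log (Real.log N) ^ (-(1 : ℝ) / 10) / 2) := by
  have ht : Filter.Tendsto (fun N : ℕ => Real.log (Real.log N)) Filter.atTop Filter.atTop :=
    Real.tendsto_log_atTop.comp (Real.tendsto_log_atTop.comp tendsto_natCast_atTop_atTop)
  obtain ⟨N₀, hN₀⟩ := Filter.eventually_atTop.1 (ht.eventually_ge_atTop 1)
  refine ⟨N₀, fun N hN εN pN _ _ h0 h1 _ => ?_⟩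
  have hL := hN₀ N hN
  have hM : 1 ≤ Real.log (Real.log N) ^ ((1 : ℝ) / 10) := Real.one_le_rpow hL (by norm_num)
  have hinv : Real.log (Real.log N) ^ (-(1 : ℝ) / 10)
      = (Real.log (Real.log N) ^ ((1 : ℝ) / 10))⁻¹ := by
    rw [neg_div, Real.rpow_neg (by linarith)]
  rw [hinv]
  obtain ⟨p, hp, hpq⟩ := pStar_aux (N := N) κ _ pN hM h0 h1
  unfold pStar
  exact ⟨le_csInf ⟨p, hp⟩ fun y hy => hy.1,
    (csInf_le ⟨pN, fun y hy => hy.1⟩ hp).trans hpq⟩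
end
end
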